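/- Let d ∈ ℕ, 1 < p < ∞, 0 < q ≤ ∞ and k ∈ ℕ with k > d/p. There is a constant C > 0 such that for every f ∈ L_{p,q}(ℝ^d) and every t > 0, t^{−d/p} (∫_0^{t^d} (u^{1/p} (f^#)^*(u))^q du/u)^{1/q} ≤ C · sup_{t < u < ∞} u^{−d/p} ω_k(f,u)_{p,q} (with the integral replaced by a supremum when q = ∞). -/

import Mathlib

open MeasureTheory ENNReal Set Filter

noncomputable section

abbrev Euc (d : ℕ) := EuclideanSpace ℝ (Fin d)

/-- Non-increasing rearrangement of an `ℝ≥0∞`-valued function w.r.t. a measure. -/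
def rearr {α : Type*} [MeasurableSpace α] (μ : Measure α) (g : α → ℝ≥0∞) (t : ℝ) : ℝ≥0∞ :=
  sInf {l : ℝ≥0∞ | μ {x | l < g x} ≤ ENNReal.ofReal t}

/-- Non-increasing rearrangement of a real-valued function. -/
def rearrR {α : Type*} [MeasurableSpace α] (μ : Measure α) (f : α → ℝ) (t : ℝ) : ℝ≥0∞ :=
  rearr μ (fun x => ENNReal.ofReal |f x|) t

/-- The maximal function `f^{**}(t) = t⁻¹ ∫_0^t f^*`. -/
def rearrStar {α : Type*} [MeasurableSpace α] (μ : Measure α) (f : α → ℝ) (t : ℝ) : ℝ≥0∞ :=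
  (ENNReal.ofReal t)⁻¹ * ∫⁻ s in Set.Ioo (0:ℝ) t, rearrR μ f s

/-- `(∫_I g(t)^q dt/t)^{1/q}`, with the usual sup modification when `q = ∞`. -/
def qnorm (q : ℝ≥0∞) (I : Set ℝ) (g : ℝ → ℝ≥0∞) : ℝ≥0∞ :=
  if q = ∞ then ⨆ t ∈ I, g t
  else (∫⁻ t in I, g t ^ q.toReal / ENNReal.ofReal t) ^ (1 / q.toReal)

/-- `∫_I g(t)^q dt/t` (no outer power), with the sup modification when `q = ∞`. -/
def qint (q : ℝ≥0∞) (I : Set ℝ) (g : ℝ → ℝ≥0∞) : ℝ≥0∞ :=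
  if q = ∞ then ⨆ t ∈ I, g t
  else ∫⁻ t in I, g t ^ q.toReal / ENNReal.ofReal t

/-- Lorentz quasinorm `(∫_I (t^{1/p} f^*(t))^q dt/t)^{1/q}`. -/
def lorentz {α : Type*} [MeasurableSpace α] (μ : Measure α) (f : α → ℝ)
    (p : ℝ) (q : ℝ≥0∞) (I : Set ℝ) : ℝ≥0∞ :=
  qnorm q I (fun t => ENNReal.ofReal (t ^ (1 / p)) * rearrR μ f t)

/-- The cube with lower-left corner `a` and side length `l`. -/
def cubeSet {d : ℕ} (a : Fin d → ℝ) (l : ℝ) : Set (Euc d) :=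
  {x | ∀ i, a i ≤ x i ∧ x i ≤ a i + l}

/-- Cubes in `ℝ^d` with sides parallel to the coordinate axes. -/
def IsCube {d : ℕ} (Q : Set (Euc d)) : Prop := ∃ a l, 0 < l ∧ Q = cubeSet a l

/-- The sharp maximal function `f^{#}` on `ℝ^d`. -/
def sharp {d : ℕ} (f : Euc d → ℝ) (x : Euc d) : ℝ≥0∞ :=
  ⨆ Q ∈ {Q : Set (Euc d) | IsCube Q ∧ x ∈ Q},
    ENNReal.ofReal (⨍ y in Q, |f y - ⨍ z in Q, f z|)

/-- The local sharp maximal function `f^{#}_{Q_0;μ}`. -/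
def sharpLocal {d : ℕ} (μ : Measure (Euc d)) (Q0 : Set (Euc d)) (f : Euc d → ℝ)
    (x : Euc d) : ℝ≥0∞ :=
  ⨆ Q ∈ {Q : Set (Euc d) | IsCube Q ∧ x ∈ Q ∧ Q ⊆ Q0},
    ENNReal.ofReal (⨍ y in Q, |f y - ⨍ z in Q, f z ∂μ| ∂μ)

def diffOp {d : ℕ} (h : Euc d) (f : Euc d → ℝ) : Euc d → ℝ := fun x => f (x + h) - f x

/-- The iterated difference `Δ_h^k f`. -/
def iterDiff {d : ℕ} (k : ℕ) (h : Euc d) (f : Euc d → ℝ) : Euc d → ℝ := (diffOp h)^[k] f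

/-- The modulus of smoothness `ω_k(f,t)_{p,q}` on `ℝ^d`. -/
def modulus {d : ℕ} (k : ℕ) (f : Euc d → ℝ) (p : ℝ) (q : ℝ≥0∞) (t : ℝ) : ℝ≥0∞ :=
  ⨆ h ∈ {h : Euc d | ‖h‖ ≤ t}, lorentz volume (iterDiff k h f) p q (Set.Ioi 0)



lemma lintegral_smul_eq {E : Type*} [NormedAddCommGroup E] [NormedSpace ℝ E] [MeasurableSpace E]
    [BorelSpace E] [FiniteDimensional ℝ E] (μ : Measure E) [μ.IsAddHaarMeasure]
    (g : E → ℝ≥0∞) {r : ℝ} (hr : 0 < r) :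
    ∫⁻ x, g (r • x) ∂μ = ENNReal.ofReal ((r ^ Module.finrank ℝ E)⁻¹) * ∫⁻ x, g x ∂μ := by
  have h := lintegral_map_equiv (μ := μ) g (Homeomorph.smulOfNeZero r hr.ne').toMeasurableEquiv
  have h2 := Measure.map_addHaar_smul μ hr.ne'
  have e : ⇑(Homeomorph.smulOfNeZero r hr.ne' : E ≃ₜ E).toMeasurableEquiv = (r • · : E → E) := by
    ext x; simp
  rw [e] at h
  rw [← h]
  rw [h2, lintegral_smul_measure, abs_of_pos (by positivity)]
  rfl

lemma lintegral_Ioi_scale (g : ℝ → ℝ≥0∞) {c : ℝ} (hc : 0 < c) :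
    ∫⁻ u in Ioi (0:ℝ), g (c * u) / ENNReal.ofReal u = ∫⁻ u in Ioi (0:ℝ), g u / ENNReal.ofReal u := by
  rw [← lintegral_indicator measurableSet_Ioi, ← lintegral_indicator measurableSet_Ioi]
  have h := lintegral_smul_eq (volume : Measure ℝ)
    (fun u => (Ioi (0:ℝ)).indicator (fun u => g u / ENNReal.ofReal u) u) hc
  simp only [Module.finrank_self, pow_one, smul_eq_mul] at h
  have h3 : ∫⁻ u, (Ioi (0:ℝ)).indicator (fun u => g u / ENNReal.ofReal u) u =
     ENNReal.ofReal c * ∫⁻ x, (Ioi (0:ℝ)).indicator (fun u => g u / ENNReal.ofReal u) (c * x) := by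
    rw [h, ← mul_assoc, ← ENNReal.ofReal_mul hc.le, mul_inv_cancel₀ hc.ne']; simp
  rw [h3, ← lintegral_const_mul' _ _ (by simp)]
  congr 1
  ext u
  by_cases hu : 0 < u
  · have : 0 < c * u := by positivity
    simp only [indicator, mem_Ioi, hu, this, if_true]
    rw [ENNReal.ofReal_mul hc.le, ENNReal.div_eq_inv_mul, ENNReal.div_eq_inv_mul, ENNReal.mul_inv (by simp) (by simp)]
    rw [← mul_assoc, ← mul_assoc, ENNReal.mul_inv_cancel (by simpa using hc) (by simp), one_mul]
  · have : ¬ 0 < c * u := by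
      rw [mul_pos_iff_of_pos_left hc]; exact hu
    simp [indicator, hu, this]

lemma qnorm_mono {q : ℝ≥0∞} {I : Set ℝ} (hI : MeasurableSet I) {g g' : ℝ → ℝ≥0∞}
    (h : ∀ u ∈ I, g u ≤ g' u) : qnorm q I g ≤ qnorm q I g' := by
  unfold qnorm
  split_ifs with hq
  · exact iSup₂_mono h
  · refine ENNReal.rpow_le_rpow ?_ (by positivity)
    refine setLIntegral_mono' hI fun u hu => ?_
    gcongr
    exact h u hu

lemma qnorm_mono_set {q : ℝ≥0∞} {I J : Set ℝ} (hI : I ⊆ J) (g : ℝ → ℝ≥0∞) :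
    qnorm q I g ≤ qnorm q J g := by
  unfold qnorm
  split_ifs with hq
  · exact biSup_mono hI
  · refine ENNReal.rpow_le_rpow ?_ (by positivity)
    exact lintegral_mono_set hI

lemma qnorm_scale (q : ℝ≥0∞) (g : ℝ → ℝ≥0∞) {c : ℝ} (hc : 0 < c) :
    qnorm q (Ioi 0) (fun u => g (c * u)) = qnorm q (Ioi 0) g := by
  unfold qnorm
  split_ifs with hq
  · apply le_antisymm
    · refine iSup₂_le fun u hu => ?_
      have hu' : 0 < u := hu
      exact le_iSup₂ (f := fun t (_ : t ∈ Ioi (0:ℝ)) => g t) (c * u) (by simp; positivity)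
    · refine iSup₂_le fun u hu => ?_
      have hu' : 0 < u := hu
      have := le_iSup₂ (f := fun t (_ : t ∈ Ioi (0:ℝ)) => g (c * t)) (c⁻¹ * u) (by simp; positivity)
      rwa [← mul_assoc, mul_inv_cancel₀ hc.ne', one_mul] at this
  · rw [lintegral_Ioi_scale (fun u => g u ^ q.toReal) hc]

lemma qnorm_const_mul {q : ℝ≥0∞} (hq0 : 0 < q) (I : Set ℝ) (g : ℝ → ℝ≥0∞) {c : ℝ≥0∞} (hc : c ≠ ∞) :
    qnorm q I (fun u => c * g u) = c * qnorm q I g := by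
  unfold qnorm
  split_ifs with hq
  · simp_rw [ENNReal.mul_iSup]
  · have hq' : 0 < q.toReal := ENNReal.toReal_pos hq0.ne' hq
    simp_rw [ENNReal.mul_rpow_of_nonneg _ _ hq'.le, mul_div_assoc]
    rw [lintegral_const_mul' _ _ (ENNReal.rpow_ne_top_of_nonneg hq'.le hc),
      ENNReal.mul_rpow_of_nonneg _ _ (by positivity), ← ENNReal.rpow_mul, mul_one_div_cancel hq'.ne',
      ENNReal.rpow_one]

/-- geometric sums in `qnorm` -/
lemma qnorm_tsum {q : ℝ≥0∞} (hq0 : 0 < q) (δ : ℝ≥0∞) (hδ : δ < 1) :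
    ∃ C : ℝ≥0∞, C ≠ ∞ ∧ ∀ (I : Set ℝ) (_ : MeasurableSet I) (g : ℕ → ℝ → ℝ≥0∞)
      (_ : ∀ j, Measurable (g j)) (N : ℝ≥0∞)
      (_ : ∀ j, qnorm q I (g j) ≤ N), qnorm q I (fun u => ∑' j, δ ^ (2 * j) * g j u) ≤ C * N := by
  have hgeo : ∀ r : ℝ≥0∞, r < 1 → ∑' j : ℕ, r ^ j ≠ ∞ := by
    intro r hr
    rw [ENNReal.tsum_geometric]
    simpa [tsub_eq_zero_iff_le] using hr
  by_cases hq : q = ∞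
  · refine ⟨∑' j : ℕ, (δ^2) ^ j, hgeo _ (by simpa using pow_lt_one₀ (by simp) hδ two_ne_zero), ?_⟩
    intro I hI g hg N hN
    simp only [qnorm, hq, if_true] at hN ⊢
    refine iSup₂_le fun u hu => ?_
    rw [← ENNReal.tsum_mul_right]
    refine ENNReal.tsum_le_tsum fun j => ?_
    rw [pow_mul]
    gcongr
    exact (le_iSup₂ (f := fun t (_ : t ∈ I) => g j t) u hu).trans (hN j)
  · have hq' : 0 < q.toReal := ENNReal.toReal_pos hq0.ne' hq
    set s := q.toReal
    set A := ∑' j : ℕ, δ ^ j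
    have hA : A ≠ ∞ := hgeo _ hδ
    set B := ∑' j : ℕ, (δ ^ s) ^ j
    have hB : B ≠ ∞ := hgeo _ (ENNReal.rpow_lt_one hδ hq')
    refine ⟨A * B ^ (1 / s), ENNReal.mul_ne_top hA (ENNReal.rpow_ne_top_of_nonneg (by positivity) hB), ?_⟩
    intro I hI g hg N hN
    simp only [qnorm, hq, if_false] at hN ⊢
    have hN' : ∀ j, ∫⁻ t in I, g j t ^ s / ENNReal.ofReal t ≤ N ^ s := by
      intro j
      have := ENNReal.rpow_le_rpow (hN j) hq'.le
      rwa [← ENNReal.rpow_mul, one_div_mul_cancel hq'.ne', ENNReal.rpow_one] at this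
    have pt : ∀ u, (∑' j, δ ^ (2 * j) * g j u) ^ s ≤ A ^ s * ∑' j, (δ ^ s) ^ j * (g j u) ^ s := by
      intro u
      have h1 : ∑' j, δ ^ (2 * j) * g j u ≤ A * ⨆ j, δ ^ j * g j u := by
        rw [← ENNReal.tsum_mul_right]
        refine ENNReal.tsum_le_tsum fun j => ?_
        rw [two_mul, pow_add, mul_assoc]
        gcongr
        exact le_iSup (fun j => δ ^ j * g j u) j
      refine (ENNReal.rpow_le_rpow h1 hq'.le).trans ?_
      rw [ENNReal.mul_rpow_of_nonneg _ _ hq'.le]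
      gcongr
      rw [← ENNReal.le_rpow_inv_iff hq']
      refine iSup_le fun j => ?_
      rw [ENNReal.le_rpow_inv_iff hq', ENNReal.mul_rpow_of_nonneg _ _ hq'.le]
      have e : (δ ^ j) ^ s = (δ ^ s) ^ j := by
        rw [← ENNReal.rpow_natCast, ← ENNReal.rpow_mul, mul_comm (j : ℝ), ENNReal.rpow_mul, ENNReal.rpow_natCast]
      rw [e]
      exact ENNReal.le_tsum (f := fun j => (δ ^ s) ^ j * g j u ^ s) j
    calc (∫⁻ t in I, (∑' j, δ ^ (2 * j) * g j t) ^ s / ENNReal.ofReal t) ^ (1 / s)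
        ≤ (A ^ s * (B * N ^ s)) ^ (1 / s) := by
          refine ENNReal.rpow_le_rpow ?_ (by positivity)
          calc _ ≤ ∫⁻ t in I, A ^ s * ∑' j, (δ ^ s) ^ j * ((g j t) ^ s / ENNReal.ofReal t) := by
                refine lintegral_mono fun t => ?_
                refine (ENNReal.div_le_div_right (pt t) _).trans ?_
                rw [mul_div_assoc, ENNReal.div_eq_inv_mul, ← ENNReal.tsum_mul_left]
                gcongr 1
                refine ENNReal.tsum_le_tsum fun j => ?_
                rw [mul_left_comm, ENNReal.div_eq_inv_mul]
            _ = A ^ s * ∑' j, (δ ^ s) ^ j * ∫⁻ t in I, ((g j t) ^ s / ENNReal.ofReal t) := by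
                rw [lintegral_const_mul' _ _ (ENNReal.rpow_ne_top_of_nonneg hq'.le hA), lintegral_tsum]
                · congr 2; ext j
                  rw [lintegral_const_mul']
                  exact ENNReal.pow_ne_top (ENNReal.rpow_ne_top_of_nonneg hq'.le (hδ.trans one_lt_top).ne)
                · intro j
                  have := hg j
                  fun_prop
            _ ≤ _ := by
                gcongr
                rw [← ENNReal.tsum_mul_right]
                gcongr with j
                exact hN' j
      _ = A * B ^ (1 / s) * N := by
          rw [ENNReal.mul_rpow_of_nonneg _ _ (by positivity), ENNReal.mul_rpow_of_nonneg _ _ (by positivity),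
            ← ENNReal.rpow_mul, ← ENNReal.rpow_mul, mul_one_div_cancel hq'.ne']
          simp [mul_assoc]


lemma qnorm_add {q : ℝ≥0∞} (hq0 : 0 < q) :
    ∃ C : ℝ≥0∞, C ≠ ∞ ∧ ∀ (I : Set ℝ) (_ : MeasurableSet I) (g g' : ℝ → ℝ≥0∞)
      (_ : Measurable g) (N : ℝ≥0∞) (_ : qnorm q I g ≤ N) (_ : qnorm q I g' ≤ N),
      qnorm q I (fun u => g u + g' u) ≤ C * N := by
  by_cases hq : q = ∞
  · refine ⟨2, by simp, ?_⟩
    intro I hI g g' hg N h h'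
    simp only [qnorm, hq, if_true] at h h' ⊢
    refine iSup₂_le fun u hu => ?_
    rw [two_mul]
    exact add_le_add ((le_iSup₂ (f := fun t (_ : t ∈ I) => g t) u hu).trans h)
      ((le_iSup₂ (f := fun t (_ : t ∈ I) => g' t) u hu).trans h')
  · have hq' : 0 < q.toReal := ENNReal.toReal_pos hq0.ne' hq
    set s := q.toReal with hs
    refine ⟨2 * 2 ^ (1 / s), by finiteness, ?_⟩
    intro I hI g g' hg N h h'
    simp only [qnorm, hq, if_false, ← hs] at h h' ⊢
    have key : ∀ g : ℝ → ℝ≥0∞, (∫⁻ t in I, g t ^ s / ENNReal.ofReal t) ^ (1 / s) ≤ N →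
        ∫⁻ t in I, g t ^ s / ENNReal.ofReal t ≤ N ^ s := by
      intro g hN
      have := ENNReal.rpow_le_rpow hN hq'.le
      rwa [← ENNReal.rpow_mul, one_div_mul_cancel hq'.ne', ENNReal.rpow_one] at this
    have pt : ∀ a b : ℝ≥0∞, (a + b) ^ s ≤ 2 ^ s * (a ^ s + b ^ s) := by
      intro a b
      have h1 : a + b ≤ 2 * max a b := by
        rw [two_mul]; exact add_le_add (le_max_left _ _) (le_max_right _ _)
      refine (ENNReal.rpow_le_rpow h1 hq'.le).trans ?_
      rw [ENNReal.mul_rpow_of_nonneg _ _ hq'.le]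
      gcongr
      rcases max_cases a b with h | h <;> rw [h.1]
      · exact le_self_add
      · exact le_add_self
    calc _ ≤ (2 ^ s * (N ^ s + N ^ s)) ^ (1 / s) := by
          refine ENNReal.rpow_le_rpow ?_ (by positivity)
          calc _ ≤ ∫⁻ t in I, 2 ^ s * (g t ^ s / ENNReal.ofReal t + g' t ^ s / ENNReal.ofReal t) := by
                refine lintegral_mono fun t => ?_
                refine (ENNReal.div_le_div_right (pt _ _) _).trans ?_
                rw [mul_div_assoc, ENNReal.add_div]
            _ = 2 ^ s * ((∫⁻ t in I, g t ^ s / ENNReal.ofReal t) + ∫⁻ t in I, g' t ^ s / ENNReal.ofReal t) := by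
                rw [lintegral_const_mul' _ _ (by finiteness), lintegral_add_left]
                fun_prop
            _ ≤ _ := by gcongr; exacts [key _ h, key _ h']
      _ = 2 * 2 ^ (1 / s) * N := by
          rw [← two_mul, ENNReal.mul_rpow_of_nonneg _ _ (by positivity), ENNReal.mul_rpow_of_nonneg _ _ (by positivity),
            ← ENNReal.rpow_mul, ← ENNReal.rpow_mul, mul_one_div_cancel hq'.ne']
          simp [mul_assoc]

/-- pointwise bound of antitone functions by the quasi-norm -/
lemma qnorm_antitone_bound {q : ℝ≥0∞} (hq0 : 0 < q) {p : ℝ} (hp : 1 < p) :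
    ∃ C : ℝ≥0∞, C ≠ ∞ ∧ ∀ (Ψ : ℝ → ℝ≥0∞) (_ : Antitone Ψ) (u : ℝ) (_ : 0 < u),
      ENNReal.ofReal (u ^ (1 / p)) * Ψ u ≤
        C * qnorm q (Ioi 0) (fun v => ENNReal.ofReal (v ^ (1 / p)) * Ψ v) := by
  have hp0 : 0 < p := by linarith
  by_cases hq : q = ∞
  · refine ⟨1, by simp, fun Ψ hΨ u hu => ?_⟩
    simp only [qnorm, hq, if_true, one_mul]
    exact le_iSup₂ (f := fun t (_ : t ∈ Ioi (0:ℝ)) => ENNReal.ofReal (t ^ (1 / p)) * Ψ t) u hu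
  · have hq' : 0 < q.toReal := ENNReal.toReal_pos hq0.ne' hq
    set s := q.toReal with hs
    refine ⟨2 ^ (1 / p) * 2 ^ (1 / s), by finiteness, fun Ψ hΨ u hu => ?_⟩
    simp only [qnorm, hq, if_false, ← hs]
    set G := ENNReal.ofReal (u ^ (1 / p)) * Ψ u with hG
    have h1 : ∀ v ∈ Ioo (u / 2) u, (G / 2 ^ (1 / p)) ^ s / ENNReal.ofReal u ≤
        (ENNReal.ofReal (v ^ (1 / p)) * Ψ v) ^ s / ENNReal.ofReal v := by
      intro v hv
      have hv0 : 0 < v := by linarith [hv.1]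
      have h2 : G / 2 ^ (1 / p) ≤ ENNReal.ofReal (v ^ (1 / p)) * Ψ v := by
        refine ENNReal.div_le_of_le_mul ?_
        rw [mul_right_comm, hG]
        refine mul_le_mul' ?_ (hΨ hv.2.le)
        rw [← ENNReal.ofReal_rpow_of_pos hu, ← ENNReal.ofReal_rpow_of_pos hv0,
          ← ENNReal.mul_rpow_of_nonneg _ _ (by positivity)]
        refine ENNReal.rpow_le_rpow ?_ (by positivity)
        rw [← ENNReal.ofReal_ofNat, ← ENNReal.ofReal_mul hv0.le]
        exact ENNReal.ofReal_le_ofReal (by linarith [hv.1])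
      refine ENNReal.div_le_div (ENNReal.rpow_le_rpow h2 hq'.le) (ENNReal.ofReal_le_ofReal hv.2.le)
    have h3 : (G / 2 ^ (1 / p)) ^ s / 2 ≤ ∫⁻ v in Ioi (0:ℝ), (ENNReal.ofReal (v ^ (1 / p)) * Ψ v) ^ s / ENNReal.ofReal v := by
      calc _ = ∫⁻ v in Ioo (u / 2) u, (G / 2 ^ (1 / p)) ^ s / ENNReal.ofReal u := by
            rw [setLIntegral_const, Real.volume_Ioo, show u - u / 2 = u / 2 by ring, ENNReal.ofReal_div_of_pos (by norm_num)]
            simp only [ENNReal.ofReal_ofNat, ENNReal.div_eq_inv_mul]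
            rw [show ∀ a b c d : ℝ≥0∞, a * b * (c * d) = c * b * (a * d) by intros; ring]
            rw [ENNReal.inv_mul_cancel (by simpa using hu) (by simp), mul_one]
        _ ≤ ∫⁻ v in Ioo (u / 2) u, (ENNReal.ofReal (v ^ (1 / p)) * Ψ v) ^ s / ENNReal.ofReal v :=
            setLIntegral_mono' measurableSet_Ioo h1
        _ ≤ _ := lintegral_mono_set fun v hv => by
            have := hv.1
            simp only [mem_Ioi]; linarith
    have h4 := ENNReal.rpow_le_rpow h3 (show 0 ≤ 1 / s by positivity)
    rw [ENNReal.div_rpow_of_nonneg _ _ (by positivity), ← ENNReal.rpow_mul, mul_one_div_cancel hq'.ne', ENNReal.rpow_one] at h4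
    rw [ENNReal.div_le_iff (by positivity) (by finiteness), ENNReal.div_le_iff (by positivity) (by finiteness)] at h4
    refine h4.trans (le_of_eq ?_)
    ring

lemma lintegral_dyadic (Ψ : ℝ → ℝ≥0∞) (hΨ : Antitone Ψ) {u : ℝ} (hu : 0 < u) :
    ∫⁻ v in Ioo (0:ℝ) u, Ψ v ≤
      ∑' j : ℕ, ENNReal.ofReal ((1 / 2) ^ (j + 1) * u) * Ψ ((1 / 2) ^ (j + 1) * u) := by
  have hsub : Ioo (0:ℝ) u ⊆ ⋃ j : ℕ, Ico ((1 / 2) ^ (j + 1) * u) ((1 / 2) ^ j * u) := by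
    intro v hv
    obtain ⟨n, h1, h2⟩ := exists_nat_pow_near_of_lt_one (x := v / u) (div_pos hv.1 hu) (by
      rw [div_le_one hu]; exact hv.2.le) (y := 1 / 2) (by norm_num) (by norm_num)
    rw [lt_div_iff₀ hu] at h1
    rw [div_le_iff₀ hu] at h2
    rcases h2.lt_or_eq with h2 | h2
    · exact mem_iUnion.2 ⟨n, h1.le, h2⟩
    · rcases n with _ | n
      · simp at h2; exact absurd hv.2 (by simp [h2])
      · refine mem_iUnion.2 ⟨n, h2.ge, ?_⟩
        rw [h2, pow_succ]
        have : (0:ℝ) < (1/2)^n * u := by positivity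
        linarith
  refine (lintegral_mono_set hsub).trans ((lintegral_iUnion_le _ _).trans ?_)
  refine ENNReal.tsum_le_tsum fun j => ?_
  calc _ ≤ ∫⁻ v in Ico ((1 / 2) ^ (j + 1) * u) ((1 / 2) ^ j * u), Ψ ((1 / 2) ^ (j + 1) * u) :=
        setLIntegral_mono' measurableSet_Ico fun v hv => hΨ hv.1
    _ = _ := by
        rw [setLIntegral_const, Real.volume_Ico, mul_comm]
        congr 2; ring

def dlt (p : ℝ) : ℝ := (1 / 2) ^ ((1 - 1 / p) / 2)

lemma dlt_lt {p : ℝ} (hp : 1 < p) : ENNReal.ofReal (dlt p) < 1 := by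
  rw [ENNReal.ofReal_lt_one]
  refine Real.rpow_lt_one (by norm_num) (by norm_num) ?_
  have : 1 / p < 1 := by rw [div_lt_one (by linarith)]; exact hp
  linarith

lemma weighted_dyadic {p : ℝ} (hp : 1 < p) (Ψ : ℝ → ℝ≥0∞) (hΨ : Antitone Ψ) {u : ℝ} (hu : 0 < u) :
    ENNReal.ofReal (u ^ (1 / p)) * ((ENNReal.ofReal u)⁻¹ * ∫⁻ v in Ioo (0:ℝ) u, Ψ v) ≤
      ∑' j : ℕ, ENNReal.ofReal (dlt p) ^ (2 * j) *
        (ENNReal.ofReal (((1 / 2) ^ (j + 1) * u) ^ (1 / p)) * Ψ ((1 / 2) ^ (j + 1) * u)) := by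
  have hp1 : 1 / p < 1 := by rw [div_lt_one (by linarith)]; exact hp
  calc _ ≤ ENNReal.ofReal (u ^ (1 / p)) * ((ENNReal.ofReal u)⁻¹ *
        ∑' j : ℕ, ENNReal.ofReal ((1 / 2) ^ (j + 1) * u) * Ψ ((1 / 2) ^ (j + 1) * u)) := by
        gcongr; exact lintegral_dyadic Ψ hΨ hu
    _ ≤ _ := by
        rw [← ENNReal.tsum_mul_left, ← ENNReal.tsum_mul_left]
        refine ENNReal.tsum_le_tsum fun j => ?_
        rw [← mul_assoc, ← mul_assoc, ← mul_assoc]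
        refine mul_le_mul_left ?_ _
        rw [← ENNReal.ofReal_inv_of_pos hu, ← ENNReal.ofReal_pow (by unfold dlt; positivity), ← ENNReal.ofReal_mul (by positivity),
          ← ENNReal.ofReal_mul (by positivity), ← ENNReal.ofReal_mul (by unfold dlt; positivity)]
        refine ENNReal.ofReal_le_ofReal ?_
        have e1 : dlt p ^ (2 * j) = (1/2 : ℝ) ^ ((1 - 1 / p) * j) := by
          unfold dlt
          rw [← Real.rpow_natCast, ← Real.rpow_mul (by norm_num)]
          congr 1; push_cast; ring
        rw [e1, Real.mul_rpow (by positivity) hu.le, ← Real.rpow_natCast, ← Real.rpow_mul (by norm_num)]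
        have e2 : u ^ (1 / p) * u⁻¹ * ((1 / 2) ^ ((j + 1 : ℕ) : ℝ) * u) = u ^ (1 / p) * (1 / 2 : ℝ) ^ ((j + 1 : ℕ) : ℝ) := by
          field_simp
        rw [e2, ← mul_assoc, ← Real.rpow_add (by norm_num), mul_comm]
        refine mul_le_mul_of_nonneg_right ?_ (by positivity)
        refine Real.rpow_le_rpow_of_exponent_ge (by norm_num) (by norm_num) ?_
        push_cast
        nlinarith

lemma hardy {q : ℝ≥0∞} (hq0 : 0 < q) {p : ℝ} (hp : 1 < p) :
    ∃ C : ℝ≥0∞, C ≠ ∞ ∧ ∀ (Ψ : ℝ → ℝ≥0∞) (_ : Antitone Ψ),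
      qnorm q (Ioi 0) (fun u => ENNReal.ofReal (u ^ (1 / p)) * ((ENNReal.ofReal u)⁻¹ * ∫⁻ v in Ioo (0:ℝ) u, Ψ v)) ≤
        C * qnorm q (Ioi 0) (fun v => ENNReal.ofReal (v ^ (1 / p)) * Ψ v) := by
  obtain ⟨C, hC, h⟩ := qnorm_tsum hq0 _ (dlt_lt hp)
  refine ⟨C, hC, fun Ψ hΨ => ?_⟩
  refine (qnorm_mono measurableSet_Ioi fun u hu => weighted_dyadic hp Ψ hΨ hu).trans ?_
  have hm := hΨ.measurable
  refine h (Ioi 0) measurableSet_Ioi (fun j u => ENNReal.ofReal (((1 / 2) ^ (j + 1) * u) ^ (1 / p)) * Ψ ((1 / 2) ^ (j + 1) * u)) ?_ _ ?_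
  · intro j; fun_prop
  · intro j
    exact (qnorm_scale q (fun v => ENNReal.ofReal (v ^ (1 / p)) * Ψ v) (by positivity)).le

/-- integral form of the embedding into weak spaces -/
lemma antitone_integral_bound {q : ℝ≥0∞} (hq0 : 0 < q) {p : ℝ} (hp : 1 < p) :
    ∃ C : ℝ≥0∞, C ≠ ∞ ∧ ∀ (Ψ : ℝ → ℝ≥0∞) (_ : Antitone Ψ) (u : ℝ) (_ : 0 < u),
      ∫⁻ v in Ioo (0:ℝ) u, Ψ v ≤
        C * ENNReal.ofReal (u ^ (1 - 1 / p)) * qnorm q (Ioi 0) (fun v => ENNReal.ofReal (v ^ (1 / p)) * Ψ v) := by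
  obtain ⟨C, hC, h⟩ := qnorm_antitone_bound hq0 hp
  refine ⟨(∑' j : ℕ, ENNReal.ofReal (dlt p) ^ (2 * j)) * C, ?_, fun Ψ hΨ u hu => ?_⟩
  · refine ENNReal.mul_ne_top ?_ hC
    simp_rw [pow_mul]
    rw [ENNReal.tsum_geometric]
    simpa [tsub_eq_zero_iff_le] using (pow_lt_one₀ (by simp) (dlt_lt hp) two_ne_zero)
  · have h1 := weighted_dyadic hp Ψ hΨ hu
    set N := qnorm q (Ioi 0) (fun v => ENNReal.ofReal (v ^ (1 / p)) * Ψ v)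
    have h2 : ENNReal.ofReal (u ^ (1 / p)) * ((ENNReal.ofReal u)⁻¹ * ∫⁻ v in Ioo (0:ℝ) u, Ψ v) ≤
        (∑' j : ℕ, ENNReal.ofReal (dlt p) ^ (2 * j)) * (C * N) := by
      refine h1.trans ?_
      rw [← ENNReal.tsum_mul_right]
      refine ENNReal.tsum_le_tsum fun j => ?_
      exact mul_le_mul_right (h Ψ hΨ _ (by positivity)) _
    have e : ENNReal.ofReal (u ^ (1 - 1 / p)) * (ENNReal.ofReal (u ^ (1 / p)) * (ENNReal.ofReal u)⁻¹) = 1 := by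
      rw [← ENNReal.ofReal_inv_of_pos hu, ← ENNReal.ofReal_mul (by positivity), ← ENNReal.ofReal_mul (by positivity),
        ← mul_assoc, ← Real.rpow_add hu]
      simp [hu.ne']
    calc _ = ENNReal.ofReal (u ^ (1 - 1 / p)) * (ENNReal.ofReal (u ^ (1 / p)) * (ENNReal.ofReal u)⁻¹) * ∫⁻ v in Ioo (0:ℝ) u, Ψ v := by
          rw [e, one_mul]
      _ = ENNReal.ofReal (u ^ (1 - 1 / p)) * (ENNReal.ofReal (u ^ (1 / p)) * ((ENNReal.ofReal u)⁻¹ * ∫⁻ v in Ioo (0:ℝ) u, Ψ v)) := by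
          ring
      _ ≤ ENNReal.ofReal (u ^ (1 - 1 / p)) * ((∑' j : ℕ, ENNReal.ofReal (dlt p) ^ (2 * j)) * (C * N)) := by gcongr
      _ = _ := by ring

lemma qnorm_pow {q : ℝ≥0∞} (hq0 : 0 < q) {p : ℝ} (hp : 1 < p) :
    ∃ C : ℝ≥0∞, C ≠ ∞ ∧ ∀ m : ℝ, 0 < m →
      qnorm q (Ioo 0 m) (fun u => ENNReal.ofReal (u ^ (1 / p))) ≤ C * ENNReal.ofReal (m ^ (1 / p)) := by
  have hp0 : 0 < p := by linarith
  by_cases hq : q = ∞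
  · refine ⟨1, by simp, fun m hm => ?_⟩
    simp only [qnorm, hq, if_true, one_mul]
    refine iSup₂_le fun u hu => ENNReal.ofReal_le_ofReal ?_
    exact Real.rpow_le_rpow hu.1.le hu.2.le (by positivity)
  · have hq' : 0 < q.toReal := ENNReal.toReal_pos hq0.ne' hq
    set s := q.toReal with hs
    refine ⟨ENNReal.ofReal (p / s) ^ (1 / s), by finiteness, fun m hm => ?_⟩
    simp only [qnorm, hq, if_false, ← hs]
    have h1 : ∫⁻ t in Ioo 0 m, ENNReal.ofReal (t ^ (1 / p)) ^ s / ENNReal.ofReal t = ENNReal.ofReal (p / s) * ENNReal.ofReal (m ^ (1 / p)) ^ s := by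
      have hi := intervalIntegral.intervalIntegrable_rpow' (a := 0) (b := m) (r := s / p - 1) (by linarith [show 0 < s / p by positivity])
      calc _ = ∫⁻ t in Ioo 0 m, ENNReal.ofReal (t ^ (s / p - 1)) := by
            refine setLIntegral_congr_fun measurableSet_Ioo fun t ht => ?_
            have ht0 : 0 < t := ht.1
            rw [ENNReal.ofReal_rpow_of_pos (by positivity), ← ENNReal.ofReal_div_of_pos ht0, ← Real.rpow_mul ht0.le,
              Real.rpow_sub ht0, Real.rpow_one]
            congr 3; ring
        _ = ENNReal.ofReal (∫ t in Ioo 0 m, t ^ (s / p - 1)) := by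
            rw [ofReal_integral_eq_lintegral_ofReal]
            · rw [intervalIntegrable_iff_integrableOn_Ioo_of_le hm.le] at hi
              exact hi
            · exact (ae_restrict_iff' measurableSet_Ioo).2 (Eventually.of_forall fun t ht => by
                have := ht.1
                simp only [Pi.zero_apply]; positivity)
        _ = _ := by
            rw [← integral_Ioc_eq_integral_Ioo, ← intervalIntegral.integral_of_le hm.le, integral_rpow (by left; linarith [show 0 < s / p by positivity])]
            rw [ENNReal.ofReal_rpow_of_pos (by positivity), ← ENNReal.ofReal_mul (by positivity), ← Real.rpow_mul hm.le]
            congr 1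
            rw [sub_add_cancel, Real.zero_rpow (by positivity), show 1 / p * s = s / p by ring]
            field_simp
            simp
    rw [h1, ENNReal.mul_rpow_of_nonneg _ _ (by positivity), ← ENNReal.rpow_mul, mul_one_div_cancel hq'.ne', ENNReal.rpow_one]



section
variable {α : Type*} [MeasurableSpace α] {μ : Measure α}

lemma rearr_antitone (g : α → ℝ≥0∞) : Antitone (rearr μ g) := by
  intro s t hst
  exact sInf_le_sInf fun l hl => le_trans hl (ENNReal.ofReal_le_ofReal hst)

lemma lt_rearr_iff (g : α → ℝ≥0∞) (t : ℝ) (l : ℝ≥0∞) :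
    l < rearr μ g t ↔ ENNReal.ofReal t < μ {x | l < g x} := by
  constructor
  · intro h
    by_contra! h2
    exact absurd (sInf_le (show l ∈ {l : ℝ≥0∞ | μ {x | l < g x} ≤ ENNReal.ofReal t} from h2)) (not_le.2 h)
  · intro h
    by_contra! h2
    refine absurd h (not_lt.2 ?_)
    rcases eq_or_ne l ∞ with rfl | hl
    · simp
    · obtain ⟨v, hv, hv2, hv3⟩ := exists_seq_strictAnti_tendsto' (x := l) (y := ∞) (lt_top_iff_ne_top.2 hl)
      have e : {x | l < g x} = ⋃ n, {x | v n < g x} := by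
        ext x
        simp only [mem_ofPred_eq, mem_iUnion]
        constructor
        · intro hx
          exact ((tendsto_order.1 hv3).2 _ hx).exists
        · rintro ⟨n, hn⟩
          exact (hv2 n).1.trans hn
      rw [e, Monotone.measure_iUnion]
      · refine iSup_le fun n => ?_
        obtain ⟨l', hl', hl2⟩ := sInf_lt_iff.1 (lt_of_le_of_lt h2 (hv2 n).1)
        refine le_trans (measure_mono ?_) hl'
        intro x hx
        exact hl2.trans hx
      · intro m n hmn x hx
        exact lt_of_le_of_lt (hv.antitone hmn) hx

lemma meas_gt_rearr_le (g : α → ℝ≥0∞) (t : ℝ) : μ {x | rearr μ g t < g x} ≤ ENNReal.ofReal t := by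
  by_contra! h
  exact lt_irrefl _ ((lt_rearr_iff g t _).2 h)

lemma rearr_le_of (g : α → ℝ≥0∞) (t : ℝ) (l : ℝ≥0∞) (h : μ {x | l < g x} ≤ ENNReal.ofReal t) :
    rearr μ g t ≤ l := sInf_le h

lemma layer_cake (ν : Measure α) [SFinite ν] {g : α → ℝ≥0∞} (hg : Measurable g) :
    ∫⁻ x, g x ∂ν = ∫⁻ l in Ioi (0:ℝ), ν {x | ENNReal.ofReal l < g x} := by
  have h1 : ∀ a : ℝ≥0∞, a = ∫⁻ l in Ioi (0:ℝ), ({l : ℝ | ENNReal.ofReal l < a}).indicator 1 l := by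
    intro a
    have hm : MeasurableSet {l : ℝ | ENNReal.ofReal l < a} := measurableSet_lt (by fun_prop) (by fun_prop)
    rw [lintegral_indicator_one hm, Measure.restrict_apply hm]
    rcases eq_or_ne a ∞ with rfl | ha
    · simp
    · have : {l : ℝ | ENNReal.ofReal l < a} ∩ Ioi 0 = Ioo 0 a.toReal := by
        ext l
        simp only [mem_inter_iff, mem_ofPred_eq, mem_Ioi, mem_Ioo]
        constructor
        · rintro ⟨h1, h2⟩
          exact ⟨h2, (ENNReal.ofReal_lt_iff_lt_toReal h2.le ha).1 h1⟩
        · rintro ⟨h1, h2⟩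
          exact ⟨(ENNReal.ofReal_lt_iff_lt_toReal h1.le ha).2 h2, h1⟩
      rw [this, Real.volume_Ioo, sub_zero, ENNReal.ofReal_toReal ha]
  calc _ = ∫⁻ x, (∫⁻ l in Ioi (0:ℝ), ({l : ℝ | ENNReal.ofReal l < g x}).indicator 1 l) ∂ν := by
        simp_rw [← h1]
    _ = ∫⁻ l in Ioi (0:ℝ), ∫⁻ x, ({l : ℝ | ENNReal.ofReal l < g x}).indicator 1 l ∂ν := by
        rw [lintegral_lintegral_swap]
        have hm : MeasurableSet {z : α × ℝ | ENNReal.ofReal z.2 < g z.1} :=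
          measurableSet_lt (by fun_prop) (by fun_prop)
        have : (Function.uncurry fun x l => ({l : ℝ | ENNReal.ofReal l < g x}).indicator (1 : ℝ → ℝ≥0∞) l) =
          ({z : α × ℝ | ENNReal.ofReal z.2 < g z.1}).indicator 1 := by
          ext ⟨x, l⟩; simp [indicator, Function.uncurry]
        rw [this]
        exact (measurable_one.indicator hm).aemeasurable
    _ = _ := by
        congr 1; ext l
        have hm : MeasurableSet {x | ENNReal.ofReal l < g x} := measurableSet_lt (by fun_prop) (by fun_prop)
        rw [← lintegral_indicator_one hm]
        congr 1

lemma setLIntegral_le_rearr [SFinite μ] {g : α → ℝ≥0∞} (hg : Measurable g) {E : Set α} (hE : MeasurableSet E)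
    {m : ℝ} (hm : μ E ≤ ENNReal.ofReal m) :
    ∫⁻ x in E, g x ∂μ ≤ ∫⁻ v in Ioo (0:ℝ) m, rearr μ g v := by
  rw [layer_cake _ hg, layer_cake _ (rearr_antitone g).measurable]
  refine lintegral_mono fun l => ?_
  have h1 : MeasurableSet {x | ENNReal.ofReal l < g x} := measurableSet_lt (by fun_prop) (by fun_prop)
  have h2 : MeasurableSet {x | ENNReal.ofReal l < rearr μ g x} :=
    measurableSet_lt (by fun_prop) (rearr_antitone g).measurable
  rw [Measure.restrict_apply h1, Measure.restrict_apply h2]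
  set D := μ {x | ENNReal.ofReal l < g x}
  have h3 : μ ({x | ENNReal.ofReal l < g x} ∩ E) ≤ min D (ENNReal.ofReal m) :=
    le_min (measure_mono inter_subset_left) ((measure_mono inter_subset_right).trans hm)
  refine h3.trans ?_
  have h4 : Ioo 0 (min D (ENNReal.ofReal m)).toReal ⊆ {x | ENNReal.ofReal l < rearr μ g x} ∩ Ioo 0 m := by
    intro v hv
    have hv2 : ENNReal.ofReal v < min D (ENNReal.ofReal m) :=
      (ENNReal.ofReal_lt_iff_lt_toReal hv.1.le (ne_top_of_le_ne_top (by simp) (min_le_right _ _))).2 hv.2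
    refine ⟨(lt_rearr_iff g v _).2 (lt_of_lt_of_le hv2 (min_le_left _ _)), hv.1, ?_⟩
    have := lt_of_lt_of_le hv2 (min_le_right _ _)
    exact (ENNReal.ofReal_lt_ofReal_iff_of_nonneg hv.1.le).1 this
  refine le_trans ?_ (measure_mono h4)
  rw [Real.volume_Ioo, sub_zero, ENNReal.ofReal_toReal (ne_top_of_le_ne_top (by simp) (min_le_right _ _))]

lemma rearr_sum_le {ι : Type*} (s : Finset ι) (hs : 0 < s.card) (c : ι → ℝ≥0∞) (g : α → ℝ≥0∞) (G : ι → α → ℝ≥0∞)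
    (h : ∀ x, g x ≤ ∑ i ∈ s, c i * G i x) (u : ℝ) (hu : 0 ≤ u) :
    rearr μ g u ≤ ∑ i ∈ s, c i * rearr μ (G i) (u / s.card) := by
  refine rearr_le_of _ _ _ ?_
  have hsub : {x | ∑ i ∈ s, c i * rearr μ (G i) (u / s.card) < g x} ⊆
      ⋃ i ∈ s, {x | rearr μ (G i) (u / s.card) < G i x} := by
    intro x hx
    by_contra hcon
    simp only [mem_iUnion, mem_ofPred_eq, not_exists, not_lt] at hcon
    refine absurd hx (not_lt.2 ((h x).trans ?_))
    exact Finset.sum_le_sum fun i hi => mul_le_mul_right (hcon i hi) _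
  refine (measure_mono hsub).trans ((measure_biUnion_finset_le _ _).trans ?_)
  refine (Finset.sum_le_sum fun i _ => meas_gt_rearr_le (G i) _).trans ?_
  rw [Finset.sum_const, nsmul_eq_mul, ENNReal.ofReal_div_of_pos (by exact_mod_cast hs), ENNReal.ofReal_natCast]
  rw [ENNReal.mul_div_cancel (by exact_mod_cast hs.ne') (by simp)]

end

/-- Hölder type inequality -/
lemma holder_set (d : ℕ) {q : ℝ≥0∞} (hq0 : 0 < q) {p : ℝ} (hp : 1 < p) :
    ∃ C : ℝ≥0∞, C ≠ ∞ ∧ ∀ (F : Euc d → ℝ) (_ : Measurable F) (E : Set (Euc d)) (_ : MeasurableSet E) (m : ℝ) (_ : 0 < m)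
      (_ : volume E ≤ ENNReal.ofReal m),
      ∫⁻ x in E, ‖F x‖ₑ ≤ C * ENNReal.ofReal (m ^ (1 - 1 / p)) * lorentz volume F p q (Ioi 0) := by
  obtain ⟨C, hC, h⟩ := antitone_integral_bound hq0 hp
  refine ⟨C, hC, fun F hF E hE m hm hEm => ?_⟩
  simp_rw [Real.enorm_eq_ofReal_abs]
  exact (setLIntegral_le_rearr (by fun_prop) hE hEm).trans (h _ (rearr_antitone _) m hm)

lemma measurable_rearr_param {β α : Type*} [MeasurableSpace α] [MeasurableSpace β] (μ : Measure α) [SFinite μ]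
    {g : β → α → ℝ≥0∞} (hg : Measurable (Function.uncurry g)) :
    Measurable (fun z : β × ℝ => rearr μ (g z.1) z.2) := by
  refine measurable_of_Ioi fun l => ?_
  have : (fun z : β × ℝ => rearr μ (g z.1) z.2) ⁻¹' Ioi l =
      {z : β × ℝ | ENNReal.ofReal z.2 < μ {x | l < g z.1 x}} := by
    ext z
    simp only [mem_preimage, mem_Ioi, lt_rearr_iff, mem_ofPred_eq]
  rw [this]
  have hm : MeasurableSet {z : β × α | l < g z.1 z.2} := measurableSet_lt measurable_const hg
  have h2 : Measurable fun b => μ (Prod.mk b ⁻¹' {z : β × α | l < g z.1 z.2}) := measurable_measure_prodMk_left hm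
  exact measurableSet_lt (by fun_prop) (h2.comp measurable_fst)

lemma rearrR_translate {d : ℕ} (F : Euc d → ℝ) (a : Euc d) (u : ℝ) :
    rearrR volume (fun x => F (x + a)) u = rearrR volume F u := by
  unfold rearrR rearr
  congr 1
  ext l
  simp only [mem_ofPred_eq]
  have : volume {x : Euc d | l < ENNReal.ofReal |F (x + a)|} = volume {x : Euc d | l < ENNReal.ofReal |F x|} :=
    measure_preimage_add_right volume a {x : Euc d | l < ENNReal.ofReal |F x|}
  rw [this]

lemma iterDiff_eq {d : ℕ} (k : ℕ) (h : Euc d) (f : Euc d → ℝ) (x : Euc d) :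
    iterDiff k h f x = ∑ i ∈ Finset.range (k + 1), ((-1 : ℝ) ^ (k - i) * (k.choose i : ℝ)) * f (x + (i : ℝ) • h) := by
  have := fwdDiff_iter_eq_sum_shift h f k x
  have e : diffOp h = fwdDiff (G := ℝ) h := rfl
  unfold iterDiff
  rw [e, this]
  refine Finset.sum_congr rfl fun i _ => ?_
  rw [zsmul_eq_mul, Nat.cast_smul_eq_nsmul]
  push_cast; rfl

lemma iterDiff_eq' {d : ℕ} (k : ℕ) (h : Euc d) (f : Euc d → ℝ) (x : Euc d) :
    (-1 : ℝ) ^ k * iterDiff k h f x = ∑ i ∈ Finset.range (k + 1), ((-1 : ℝ) ^ i * (k.choose i : ℝ)) * f (x + (i : ℝ) • h) := by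
  rw [iterDiff_eq, Finset.mul_sum]
  refine Finset.sum_congr rfl fun i hi => ?_
  have hik : i ≤ k := by simp at hi; omega
  rw [← mul_assoc, ← mul_assoc, ← pow_add]
  have : (-1 : ℝ) ^ (k + (k - i)) = (-1) ^ i := by
    rw [show k + (k - i) = 2 * (k - i) + i by omega, pow_add, pow_mul]; simp
  rw [this]

lemma iterDiff_zero {d : ℕ} {k : ℕ} (hk : 0 < k) (f : Euc d → ℝ) (x : Euc d) : iterDiff k 0 f x = 0 := by
  obtain ⟨k, rfl⟩ : ∃ j, k = j + 1 := ⟨k - 1, by omega⟩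
  unfold iterDiff
  rw [Function.iterate_succ_apply']
  simp [diffOp]

/-- the shift identity for differences -/
lemma diff_identity {d : ℕ} {k : ℕ} (hk : 0 < k) (f : Euc d → ℝ) (h s x : Euc d) :
    iterDiff k h f x =
      ∑ i ∈ Finset.Icc 1 k, ((-1 : ℝ) ^ i * (k.choose i : ℝ)) *
        (iterDiff k ((i : ℝ) • s) f (x + (i : ℝ) • h) - iterDiff k (h + (i : ℝ) • s) f x) := by
  have hr : Finset.range (k + 1) = insert 0 (Finset.Icc 1 k) := by
    ext i; simp; omega
  have key : ∑ l ∈ Finset.range (k + 1), ((-1 : ℝ) ^ l * (k.choose l : ℝ)) * iterDiff k (h + (l : ℝ) • s) f x =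
      ∑ i ∈ Finset.range (k + 1), ((-1 : ℝ) ^ i * (k.choose i : ℝ)) * iterDiff k ((i : ℝ) • s) f (x + (i : ℝ) • h) := by
    have h1 : ((-1 : ℝ) ^ k) * ((-1 : ℝ) ^ k) = 1 := by rw [← pow_add, ← two_mul, pow_mul]; simp
    have h2 : ((-1 : ℝ) ^ k) ≠ 0 := by positivity
    apply mul_left_cancel₀ h2
    rw [Finset.mul_sum, Finset.mul_sum]
    simp_rw [mul_left_comm ((-1 : ℝ) ^ k), iterDiff_eq', Finset.mul_sum]
    rw [Finset.sum_comm]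
    refine Finset.sum_congr rfl fun i _ => Finset.sum_congr rfl fun l _ => ?_
    have : x + (i : ℝ) • (h + (l : ℝ) • s) = x + (i : ℝ) • h + (l : ℝ) • (i : ℝ) • s := by
      rw [smul_add, add_assoc, smul_comm]
    rw [this]; ring
  rw [hr, Finset.sum_insert (by simp), Finset.sum_insert (by simp)] at key
  simp only [pow_zero, Nat.choose_zero_right, Nat.cast_zero, zero_smul, add_zero, iterDiff_zero hk] at key
  simp_rw [mul_sub, Finset.sum_sub_distrib]
  push_cast at key
  linarith



def Psi {d : ℕ} (k : ℕ) (f : Euc d → ℝ) (t u : ℝ) : ℝ≥0∞ :=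
  ⨆ h ∈ {h : Euc d | ‖h‖ ≤ t}, rearrR volume (iterDiff k h f) u

lemma Psi_antitone {d : ℕ} (k : ℕ) (f : Euc d → ℝ) (t : ℝ) : Antitone (Psi k f t) := by
  intro u v huv
  exact iSup₂_mono fun h _ => rearr_antitone _ huv

lemma rpow_sum_le {ι : Type*} (S : Finset ι) (x : ι → ℝ≥0∞) {σ : ℝ} (hσ : 0 < σ) :
    (∑ i ∈ S, x i) ^ σ ≤ (S.card : ℝ≥0∞) ^ σ * ∑ i ∈ S, x i ^ σ := by
  rcases S.eq_empty_or_nonempty with rfl | hS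
  · simp [hσ]
  · obtain ⟨j, hj, hmax⟩ := S.exists_max_image x hS
    have h1 : ∑ i ∈ S, x i ≤ S.card * x j := by
      have := Finset.sum_le_card_nsmul S x (x j) hmax
      simpa using this
    refine (ENNReal.rpow_le_rpow h1 hσ.le).trans ?_
    rw [ENNReal.mul_rpow_of_nonneg _ _ hσ.le]
    gcongr
    exact Finset.single_le_sum (f := fun i => x i ^ σ) (fun _ _ => zero_le) hj

lemma measurable_iterDiff_param {d : ℕ} (k : ℕ) {f : Euc d → ℝ} (hf : Measurable f) :
    Measurable (Function.uncurry fun (h x : Euc d) => iterDiff k h f x) := by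
  have : (Function.uncurry fun (h x : Euc d) => iterDiff k h f x) = fun z : Euc d × Euc d =>
     ∑ i ∈ Finset.range (k + 1), ((-1 : ℝ) ^ (k - i) * (k.choose i : ℝ)) * f (z.2 + (i : ℝ) • z.1) := by
    ext ⟨h, x⟩
    simp only [Function.uncurry, iterDiff_eq]
  rw [this]
  fun_prop

lemma measurable_iterDiff {d : ℕ} (k : ℕ) {f : Euc d → ℝ} (hf : Measurable f) (h : Euc d) :
    Measurable (iterDiff k h f) :=
  (measurable_iterDiff_param k hf).comp (measurable_prodMk_left (x := h))

lemma lintegral_ball_shift {d : ℕ} (H : Euc d → ℝ≥0∞) (v : Euc d) (i : ℕ) (hi : 1 ≤ i)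
    {t R : ℝ} (hv : ‖v‖ + i * t ≤ R) :
    ∫⁻ s in Metric.closedBall 0 t, H (v + (i : ℝ) • s) ≤ ∫⁻ w in Metric.closedBall 0 R, H w := by
  have hi' : (1:ℝ) ≤ i := by exact_mod_cast hi
  rw [← lintegral_indicator Metric.isClosed_closedBall.measurableSet, ← lintegral_indicator Metric.isClosed_closedBall.measurableSet]
  set K := (Metric.closedBall (0 : Euc d) R).indicator H
  calc _ ≤ ∫⁻ s, K (v + (i : ℝ) • s) := by
        refine lintegral_mono fun s => ?_
        by_cases hs : s ∈ Metric.closedBall (0 : Euc d) t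
        swap
        · rw [indicator_of_notMem hs]; exact zero_le
        rw [indicator_of_mem hs]
        rw [mem_closedBall_zero_iff] at hs
        have : v + (i : ℝ) • s ∈ Metric.closedBall (0 : Euc d) R := by
          rw [mem_closedBall_zero_iff]
          refine (norm_add_le _ _).trans (le_trans ?_ hv)
          rw [norm_smul, Real.norm_natCast]
          gcongr
        simp only [K, indicator_of_mem this]
        exact le_rfl
    _ = ENNReal.ofReal (((i : ℝ) ^ Module.finrank ℝ (Euc d))⁻¹) * ∫⁻ s, K (v + s) :=
        lintegral_smul_eq volume (fun s => K (v + s)) (by positivity)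
    _ ≤ 1 * ∫⁻ s, K s := by
        rw [lintegral_add_left_eq_self]
        gcongr
        rw [ENNReal.ofReal_le_one]
        exact inv_le_one_of_one_le₀ (one_le_pow₀ hi')
    _ = _ := one_mul _

lemma rearr_diff_le {d k : ℕ} (hk : 0 < k) (f : Euc d → ℝ) (h s : Euc d) {u : ℝ} (hu : 0 ≤ u) :
    rearrR volume (iterDiff k h f) u ≤ ∑ z ∈ Finset.Icc 1 k ×ˢ (Finset.univ : Finset Bool), 2 ^ k *
      rearrR volume (iterDiff k ((if z.2 then 0 else h) + (z.1 : ℝ) • s) f) (u / (2 * k)) := by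
  set S := Finset.Icc 1 k ×ˢ (Finset.univ : Finset Bool)
  have hS : S.card = 2 * k := by simp [S]; ring
  have hb := rearr_sum_le (μ := (volume : Measure (Euc d))) S (by omega) (fun _ => 2 ^ k)
    (fun x => ENNReal.ofReal |iterDiff k h f x|)
    (fun z x => ENNReal.ofReal |iterDiff k ((if z.2 then 0 else h) + (z.1 : ℝ) • s) f (x + if z.2 then (z.1 : ℝ) • h else 0)|) ?_ u hu
  · rw [hS] at hb
    push_cast at hb
    refine hb.trans (le_of_eq ?_)
    refine Finset.sum_congr rfl fun z _ => ?_
    congr 1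
    exact rearrR_translate (iterDiff k ((if z.2 then 0 else h) + (z.1 : ℝ) • s) f) _ _
  · intro x
    rw [diff_identity hk f h s x]
    rw [Finset.sum_product]
    have : ∀ a, ENNReal.ofReal |a| = ‖a‖ₑ := fun a => (Real.enorm_eq_ofReal_abs a).symm
    simp_rw [this]
    refine (enorm_sum_le _ _).trans (Finset.sum_le_sum fun i hi => ?_)
    rw [enorm_mul, enorm_mul, Fintype.sum_bool]
    simp only [if_true, zero_add, Bool.false_eq_true, if_false, add_zero]
    rw [← mul_add]
    refine mul_le_mul' ?_ (enorm_sub_le)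
    simp only [enorm_pow, enorm_neg, enorm_one, one_pow, one_mul]
    rw [Real.enorm_natCast]
    have : k.choose i ≤ 2 ^ k := Nat.choose_le_two_pow k i
    exact_mod_cast this

lemma psi_bound (d : ℕ) {q : ℝ≥0∞} (hq0 : 0 < q) {p : ℝ} (hp : 1 < p) {k : ℕ} (hk : 0 < k) :
    ∃ C : ℝ≥0∞, C ≠ ∞ ∧ ∀ (f : Euc d → ℝ) (_ : Measurable f) (t : ℝ) (_ : 0 < t),
      qnorm q (Ioi 0) (fun u => ENNReal.ofReal (u ^ (1 / p)) * Psi k f t u) ≤ C * modulus k f p q ((k + 1) * t) := by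
  have hp0 : 0 < p := by linarith
  have hk' : (0:ℝ) < k := by exact_mod_cast hk
  by_cases hq : q = ∞
  · refine ⟨1, by simp, fun f hf t ht => ?_⟩
    rw [one_mul]
    unfold modulus lorentz
    simp only [qnorm, hq, if_true]
    refine iSup₂_le fun u hu => ?_
    unfold Psi
    simp_rw [ENNReal.mul_iSup]
    refine iSup₂_le fun h hh => ?_
    have hh' : ‖h‖ ≤ t := hh
    refine le_trans ?_ (le_iSup₂ (f := fun (h : Euc d) (_ : h ∈ {h : Euc d | ‖h‖ ≤ (k + 1) * t}) =>
      ⨆ u ∈ Ioi (0:ℝ), ENNReal.ofReal (u ^ (1 / p)) * rearrR volume (iterDiff k h f) u) h ?_)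
    · exact le_iSup₂ (f := fun u (_ : u ∈ Ioi (0:ℝ)) => ENNReal.ofReal (u ^ (1 / p)) * rearrR volume (iterDiff k h f) u) u hu
    · show ‖h‖ ≤ (k + 1) * t
      nlinarith
  · have hσ : 0 < q.toReal := ENNReal.toReal_pos hq0.ne' hq
    set σ := q.toReal with hs
    set S := Finset.Icc 1 k ×ˢ (Finset.univ : Finset Bool) with hSdef
    set C1 : ℝ≥0∞ := (S.card : ℝ≥0∞) ^ σ * (S.card * ((2 ^ k : ℝ≥0∞) ^ σ)) with hC1
    have hC1t : C1 ≠ ∞ := by finiteness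
    set n : ℝ := 2 * k with hn
    have hn0 : 0 < n := by positivity
    refine ⟨(C1 * ((k + 1 : ℝ≥0∞) ^ d * ENNReal.ofReal (n ^ (1 / p)) ^ σ)) ^ (1 / σ), by finiteness, fun f hf t ht => ?_⟩
    set B := Metric.closedBall (0 : Euc d) t
    set R := (k + 1) * t with hR
    set B' := Metric.closedBall (0 : Euc d) R
    have hB0 : volume B ≠ 0 := (Metric.measure_closedBall_pos volume _ ht).ne'
    have hBt : volume B ≠ ∞ := measure_closedBall_lt_top.ne
    have hB' : volume B' = (k + 1 : ℝ≥0∞) ^ d * volume B := by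
      have := Measure.addHaar_closedBall_mul (volume : Measure (Euc d)) 0 (r := k + 1) (by positivity) ht.le
      simp only [finrank_euclideanSpace, Fintype.card_fin] at this
      rw [ENNReal.ofReal_pow (by positivity), ENNReal.ofReal_add (by positivity) (by simp), ENNReal.ofReal_natCast, ENNReal.ofReal_one] at this
      exact this
    set a : Euc d → ℝ → ℝ≥0∞ := fun w u => rearrR volume (iterDiff k w f) u with ha
    have ham : Measurable (Function.uncurry a) := by
      have := measurable_rearr_param (volume : Measure (Euc d)) (g := fun (w x : Euc d) => ENNReal.ofReal |iterDiff k w f x|) (by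
        have := measurable_iterDiff_param k hf
        exact (this.abs).ennreal_ofReal)
      exact this
    have step1 : ∀ u, 0 < u → ∀ h : Euc d, ‖h‖ ≤ t → a h u ^ σ * volume B ≤ C1 * ∫⁻ w in B', a w (u / n) ^ σ := by
      intro u hu h hh
      calc a h u ^ σ * volume B = ∫⁻ s in B, a h u ^ σ := by rw [setLIntegral_const]
        _ ≤ ∫⁻ s in B, (S.card : ℝ≥0∞) ^ σ * ∑ z ∈ S, (2 ^ k : ℝ≥0∞) ^ σ * a ((if z.2 then 0 else h) + (z.1 : ℝ) • s) (u / n) ^ σ := by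
            refine lintegral_mono fun s => ?_
            refine (ENNReal.rpow_le_rpow (rearr_diff_le hk f h s hu.le) hσ.le).trans ?_
            refine (rpow_sum_le _ _ hσ).trans ?_
            simp_rw [ENNReal.mul_rpow_of_nonneg _ _ hσ.le]
            exact le_rfl
        _ = (S.card : ℝ≥0∞) ^ σ * ∑ z ∈ S, (2 ^ k : ℝ≥0∞) ^ σ * ∫⁻ s in B, a ((if z.2 then 0 else h) + (z.1 : ℝ) • s) (u / n) ^ σ := by
            have hmm : ∀ z : ℕ × Bool, Measurable fun s => a ((if z.2 then 0 else h) + (z.1 : ℝ) • s) (u / n) ^ σ := by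
              intro z
              have : Measurable fun s : Euc d => Function.uncurry a ((if z.2 then 0 else h) + (z.1 : ℝ) • s, u / n) :=
                ham.comp (by fun_prop)
              exact this.pow_const σ
            rw [lintegral_const_mul' _ _ (by finiteness), lintegral_finsetSum _ (fun z _ => (hmm z).const_mul _)]
            congr 1
            refine Finset.sum_congr rfl fun z _ => ?_
            rw [lintegral_const_mul' _ _ (by finiteness)]
        _ ≤ (S.card : ℝ≥0∞) ^ σ * ∑ z ∈ S, (2 ^ k : ℝ≥0∞) ^ σ * ∫⁻ w in B', a w (u / n) ^ σ := by
            refine mul_le_mul_right (Finset.sum_le_sum fun z hz => mul_le_mul_right ?_ _) _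
            have hz1 : 1 ≤ z.1 ∧ z.1 ≤ k := by simp [S] at hz; exact hz
            refine lintegral_ball_shift (fun w => a w (u / n) ^ σ) _ z.1 hz1.1 ?_
            have h1 : ‖(if z.2 then (0 : Euc d) else h)‖ ≤ t := by
              split_ifs
              · simpa using ht.le
              · exact hh
            have h2 : (z.1 : ℝ) ≤ k := by exact_mod_cast hz1.2
            rw [hR]
            nlinarith
        _ = _ := by
            rw [Finset.sum_const, nsmul_eq_mul, hC1]; ring
    have step2 : ∀ u, 0 < u → Psi k f t u ^ σ ≤ C1 / volume B * ∫⁻ w in B', a w (u / n) ^ σ := by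
      intro u hu
      rw [← ENNReal.le_rpow_inv_iff hσ]
      refine iSup₂_le fun h hh => ?_
      rw [ENNReal.le_rpow_inv_iff hσ, ENNReal.div_eq_inv_mul, mul_assoc, mul_comm, ← ENNReal.div_eq_inv_mul.trans (mul_comm _ _), ENNReal.le_div_iff_mul_le (.inl hB0) (.inl hBt)]
      exact step1 u hu h hh
    set ω := modulus k f p q R
    have step3 : ∀ w ∈ B', ∫⁻ u in Ioi (0:ℝ), (ENNReal.ofReal (u ^ (1 / p)) * a w (u / n)) ^ σ / ENNReal.ofReal u ≤
        ENNReal.ofReal (n ^ (1 / p)) ^ σ * ω ^ σ := by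
      intro w hw
      have hw' : ‖w‖ ≤ R := by simpa [B'] using hw
      have h1 : lorentz volume (iterDiff k w f) p q (Ioi 0) ≤ ω :=
        le_iSup₂ (f := fun (h : Euc d) (_ : h ∈ {h : Euc d | ‖h‖ ≤ R}) => lorentz volume (iterDiff k h f) p q (Ioi 0)) w hw'
      simp only [lorentz, qnorm, hq, if_false, ← hs, one_div σ] at h1
      rw [ENNReal.rpow_inv_le_iff hσ] at h1
      rw [← lintegral_Ioi_scale (fun u => (ENNReal.ofReal (u ^ (1 / p)) * a w (u / n)) ^ σ) hn0]
      calc _ = ∫⁻ u in Ioi (0:ℝ), ENNReal.ofReal (n ^ (1 / p)) ^ σ * ((ENNReal.ofReal (u ^ (1 / p)) * a w u) ^ σ / ENNReal.ofReal u) := by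
            refine setLIntegral_congr_fun measurableSet_Ioi fun u hu => ?_
            have hu' : (0:ℝ) < u := hu
            rw [mul_div_cancel_left₀ _ hn0.ne', Real.mul_rpow hn0.le hu'.le, ENNReal.ofReal_mul (by positivity), mul_assoc,
              ENNReal.mul_rpow_of_nonneg _ _ hσ.le, mul_div_assoc]
        _ ≤ _ := by
            rw [lintegral_const_mul' _ _ (by finiteness)]
            gcongr
    simp only [qnorm, hq, if_false, ← hs]
    have step4 : ∫⁻ u in Ioi (0:ℝ), (ENNReal.ofReal (u ^ (1 / p)) * Psi k f t u) ^ σ / ENNReal.ofReal u ≤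
        C1 * ((k + 1 : ℝ≥0∞) ^ d * ENNReal.ofReal (n ^ (1 / p)) ^ σ) * ω ^ σ := by
      calc _ ≤ ∫⁻ u in Ioi (0:ℝ), C1 / volume B * ∫⁻ w in B', (ENNReal.ofReal (u ^ (1 / p)) * a w (u / n)) ^ σ / ENNReal.ofReal u := by
            refine setLIntegral_mono' measurableSet_Ioi fun u hu => ?_
            have hu' : (0:ℝ) < u := hu
            simp_rw [ENNReal.mul_rpow_of_nonneg _ _ hσ.le]
            calc _ ≤ ENNReal.ofReal (u ^ (1 / p)) ^ σ * (C1 / volume B * ∫⁻ w in B', a w (u / n) ^ σ) / ENNReal.ofReal u := by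
                  gcongr; exact step2 u hu'
              _ = C1 / volume B * ∫⁻ w in B', (ENNReal.ofReal (u ^ (1 / p)) ^ σ / ENNReal.ofReal u) * a w (u / n) ^ σ := by
                  rw [lintegral_const_mul']
                  · simp only [div_eq_mul_inv]; ring
                  · exact ENNReal.div_ne_top (by finiteness) (by simpa using hu')
              _ ≤ _ := by
                  simp only [div_eq_mul_inv]
                  gcongr 2
                  exact le_of_eq (by ring)
        _ = C1 / volume B * ∫⁻ w in B', ∫⁻ u in Ioi (0:ℝ), (ENNReal.ofReal (u ^ (1 / p)) * a w (u / n)) ^ σ / ENNReal.ofReal u := by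
            rw [lintegral_const_mul' _ _ (ENNReal.div_ne_top hC1t hB0), lintegral_lintegral_swap]
            refine Measurable.aemeasurable ?_
            have h1 : Measurable fun z : ℝ × Euc d => Function.uncurry a (z.2, z.1 / n) := ham.comp (by fun_prop)
            have h2 : Measurable fun z : ℝ × Euc d => (ENNReal.ofReal (z.1 ^ (1 / p)) * Function.uncurry a (z.2, z.1 / n)) ^ σ / ENNReal.ofReal z.1 := by
              fun_prop
            exact h2
        _ ≤ C1 / volume B * ∫⁻ w in B', ENNReal.ofReal (n ^ (1 / p)) ^ σ * ω ^ σ := by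
            gcongr 1
            exact setLIntegral_mono' Metric.isClosed_closedBall.measurableSet step3
        _ = _ := by
            rw [setLIntegral_const, hB', div_eq_mul_inv]
            calc _ = C1 * ((k + 1 : ℝ≥0∞) ^ d * ENNReal.ofReal (n ^ (1 / p)) ^ σ) * ω ^ σ * ((volume B)⁻¹ * volume B) := by ring
              _ = _ := by rw [ENNReal.inv_mul_cancel hB0 hBt, mul_one]
    refine (ENNReal.rpow_le_rpow step4 (by positivity)).trans ?_
    rw [ENNReal.mul_rpow_of_nonneg _ _ (by positivity), ← ENNReal.rpow_mul ω, mul_one_div_cancel hσ.ne', ENNReal.rpow_one]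



structure Ker {d : ℕ} (ψ : Euc d → ℝ) (M R L : ℝ) : Prop where
  cont : Continuous ψ
  bd : ∀ h, |ψ h| ≤ M
  supp : ∀ h, R < ‖h‖ → ψ h = 0
  lip : ∀ h h', |ψ h - ψ h'| ≤ L * ‖h - h'‖

structure Nice {d : ℕ} (F : Euc d → ℝ) : Prop where
  meas : Measurable F
  fin : ∀ x r, ∫⁻ z in Metric.closedBall x r, ‖F z‖ₑ ≠ ∞

def cv {d : ℕ} (ψ F : Euc d → ℝ) (x : Euc d) : ℝ := ∫ h, ψ h * F (x + h)

section
variable {d : ℕ} {ψ χ F G : Euc d → ℝ} {M R L M' R' L' : ℝ}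

lemma Ker.lint (hψ : Ker ψ M R L) (F : Euc d → ℝ) (x : Euc d) :
    ∫⁻ h, ‖ψ h * F (x + h)‖ₑ ≤ ENNReal.ofReal M * ∫⁻ z in Metric.closedBall x R, ‖F z‖ₑ := by
  have e := lintegral_add_left_eq_self (μ := (volume : Measure (Euc d))) (fun z => ‖ψ (z - x) * F z‖ₑ) x
  simp only [add_sub_cancel_left] at e
  rw [e, ← lintegral_const_mul' _ _ (by simp), ← lintegral_indicator Metric.isClosed_closedBall.measurableSet]
  refine lintegral_mono fun z => ?_
  by_cases hz : z ∈ Metric.closedBall x R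
  · rw [indicator_of_mem hz, enorm_mul, Real.enorm_eq_ofReal_abs (ψ (z - x))]
    gcongr
    exact hψ.bd _
  · rw [indicator_of_notMem hz, hψ.supp]
    · simp
    · rw [Metric.mem_closedBall, dist_eq_norm] at hz
      exact not_le.1 hz

lemma Ker.integrable (hψ : Ker ψ M R L) (hF : Nice F) (x : Euc d) :
    Integrable (fun h => ψ h * F (x + h)) := by
  have h1 := hψ.cont.measurable
  have h2 := hF.meas
  refine ⟨by fun_prop, ?_⟩
  exact lt_of_le_of_lt (hψ.lint F x) (ENNReal.mul_lt_top (by simp) (hF.fin x R).lt_top)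

lemma Ker.enorm_cv_le (hψ : Ker ψ M R L) (F : Euc d → ℝ) (x : Euc d) :
    ‖cv ψ F x‖ₑ ≤ ENNReal.ofReal M * ∫⁻ z in Metric.closedBall x R, ‖F z‖ₑ :=
  (enorm_integral_le_lintegral_enorm _).trans (hψ.lint F x)

lemma cv_eq (ψ F : Euc d → ℝ) (x : Euc d) : cv ψ F x = ∫ z, ψ (z - x) * F z := by
  have e := integral_add_left_eq_self (μ := (volume : Measure (Euc d))) (fun z => ψ (z - x) * F z) x
  simp only [add_sub_cancel_left] at e
  exact e

lemma Ker.integrable' (hψ : Ker ψ M R L) (hF : Nice F) (x : Euc d) :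
    Integrable (fun z => ψ (z - x) * F z) := by
  have := Integrable.comp_sub_right (hψ.integrable hF x) x
  simpa only [add_sub_cancel] using this

lemma Ker.enorm_cv_sub_le (hψ : Ker ψ M R L) (hF : Nice F) (x y : Euc d) :
    ‖cv ψ F x - cv ψ F y‖ₑ ≤ ENNReal.ofReal (L * ‖x - y‖) *
      ∫⁻ z in Metric.closedBall x (R + ‖x - y‖), ‖F z‖ₑ := by
  rw [cv_eq, cv_eq, ← integral_sub (hψ.integrable' hF x) (hψ.integrable' hF y)]
  refine (enorm_integral_le_lintegral_enorm _).trans ?_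
  rw [← lintegral_const_mul' _ _ (by simp), ← lintegral_indicator Metric.isClosed_closedBall.measurableSet]
  refine lintegral_mono fun z => ?_
  rw [← sub_mul, enorm_mul]
  by_cases hz : z ∈ Metric.closedBall x (R + ‖x - y‖)
  · rw [indicator_of_mem hz, Real.enorm_eq_ofReal_abs]
    gcongr
    have := hψ.lip (z - x) (z - y)
    rwa [show z - x - (z - y) = y - x by abel, norm_sub_rev] at this
  · rw [Metric.mem_closedBall, dist_eq_norm, not_le] at hz
    have h1 : ψ (z - x) = 0 := hψ.supp _ (by linarith [norm_nonneg (x - y)])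
    have h2 : ψ (z - y) = 0 := hψ.supp _ (by
      have := norm_sub_le_norm_sub_add_norm_sub z y x
      rw [norm_sub_rev y x] at this
      linarith)
    rw [h1, h2]; simp

lemma Ker.cv_sub (hψ : Ker ψ M R L) (hF : Nice F) (hG : Nice G) (x : Euc d) :
    cv ψ (fun y => F y - G y) x = cv ψ F x - cv ψ G x := by
  unfold cv
  rw [← integral_sub (hψ.integrable hF x) (hψ.integrable hG x)]
  simp_rw [mul_sub]

lemma Nice.sub (hF : Nice F) (hG : Nice G) : Nice (fun y => F y - G y) := by
  refine ⟨hF.meas.sub hG.meas, fun x r => ?_⟩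
  refine ne_top_of_le_ne_top (ENNReal.add_ne_top.2 ⟨hF.fin x r, hG.fin x r⟩) ?_
  rw [← lintegral_add_left hF.meas.enorm]
  exact lintegral_mono fun z => enorm_sub_le

lemma Ker.nice (hψ : Ker ψ M R L) (hF : Nice F) : Nice (cv ψ F) := by
  refine ⟨?_, fun x r => ?_⟩
  · have h1 := hψ.cont.measurable
    have h2 := hF.meas
    have : StronglyMeasurable (Function.uncurry fun (x h : Euc d) => ψ h * F (x + h)) := by
      apply Measurable.stronglyMeasurable
      unfold Function.uncurry
      fun_prop
    exact this.integral_prod_right.measurable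
  · have : ∫⁻ z in Metric.closedBall x r, ‖cv ψ F z‖ₑ ≤ ∫⁻ z in Metric.closedBall x r,
        (ENNReal.ofReal M * ∫⁻ z in Metric.closedBall x (r + R), ‖F z‖ₑ) := by
      refine setLIntegral_mono' Metric.isClosed_closedBall.measurableSet fun z hz => ?_
      refine (hψ.enorm_cv_le F z).trans ?_
      gcongr 1
      refine lintegral_mono_set (Metric.closedBall_subset_closedBall' ?_)
      rw [Metric.mem_closedBall] at hz
      linarith
    refine ne_top_of_le_ne_top ?_ this
    rw [setLIntegral_const]
    exact ENNReal.mul_ne_top (ENNReal.mul_ne_top (by simp) (hF.fin _ _)) measure_closedBall_lt_top.ne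

lemma Ker.comm (hψ : Ker ψ M R L) (hχ : Ker χ M' R' L') (hF : Nice F) (x : Euc d) :
    cv ψ (cv χ F) x = cv χ (cv ψ F) x := by
  unfold cv
  simp_rw [← integral_const_mul]
  rw [integral_integral_swap]
  · congr 1; ext h; congr 1; ext h'
    rw [add_right_comm]; ring
  · have h1 := hψ.cont.measurable
    have h2 := hF.meas
    have h3 := hχ.cont.measurable
    refine ⟨Measurable.aestronglyMeasurable (by unfold Function.uncurry; fun_prop), ?_⟩
    unfold HasFiniteIntegral
    rw [lintegral_prod _ (by unfold Function.uncurry; fun_prop)]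
    simp only [Function.uncurry]
    have : ∀ h : Euc d, ∫⁻ h', ‖ψ h * (χ h' * F (x + h + h'))‖ₑ ≤
        (Metric.closedBall (0 : Euc d) R).indicator (fun _ => ENNReal.ofReal M * (ENNReal.ofReal M' *
          ∫⁻ z in Metric.closedBall x (R + R'), ‖F z‖ₑ)) h := by
      intro h
      by_cases hh : h ∈ Metric.closedBall (0 : Euc d) R
      · rw [indicator_of_mem hh]
        simp_rw [enorm_mul (ψ h)]
        rw [lintegral_const_mul' _ _ (by simp), Real.enorm_eq_ofReal_abs]
        refine mul_le_mul' (ENNReal.ofReal_le_ofReal (hψ.bd h)) ((hχ.lint F (x + h)).trans ?_)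
        gcongr 1
        refine lintegral_mono_set (Metric.closedBall_subset_closedBall' ?_)
        rw [mem_closedBall_zero_iff] at hh
        simp; linarith
      · rw [indicator_of_notMem hh, hψ.supp]
        · simp
        · rw [mem_closedBall_zero_iff] at hh
          exact not_le.1 hh
    refine lt_of_le_of_lt (lintegral_mono this) ?_
    rw [lintegral_indicator Metric.isClosed_closedBall.measurableSet, setLIntegral_const]
    exact ENNReal.mul_lt_top (ENNReal.mul_lt_top (by simp) (ENNReal.mul_lt_top (by simp) (hF.fin _ _).lt_top)) measure_closedBall_lt_top
end

/-! tent kernels -/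

def Zc (d : ℕ) : ℝ := ∫ h : Euc d, max 0 (1 - ‖h‖)

def tent (d : ℕ) (s : ℝ) (h : Euc d) : ℝ := (Zc d)⁻¹ * (s ^ d)⁻¹ * max 0 (1 - ‖h‖ / s)

lemma tent_supp0 {d : ℕ} : HasCompactSupport (fun h : Euc d => max 0 (1 - ‖h‖)) := by
  refine HasCompactSupport.intro (isCompact_closedBall (0 : Euc d) 1) fun x hx => ?_
  rw [mem_closedBall_zero_iff, not_le] at hx
  exact max_eq_left (by linarith)

lemma Zc_pos (d : ℕ) : 0 < Zc d := by
  have hc : Continuous (fun h : Euc d => max 0 (1 - ‖h‖)) := by fun_prop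
  refine hc.integral_pos_of_hasCompactSupport_nonneg_nonzero tent_supp0 (fun x => le_max_left _ _) (x := 0) (by simp)

lemma tent_nonneg {d : ℕ} {s : ℝ} (hs : 0 < s) (h : Euc d) : 0 ≤ tent d s h := by
  have := Zc_pos d
  unfold tent; positivity

lemma tent_ker {d : ℕ} {s : ℝ} (hs : 0 < s) : Ker (tent d s) ((Zc d)⁻¹ * (s ^ d)⁻¹) s ((Zc d)⁻¹ * (s ^ d)⁻¹ * s⁻¹) := by
  have hZ := Zc_pos d
  have hc : 0 ≤ (Zc d)⁻¹ * (s ^ d)⁻¹ := by positivity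
  refine ⟨by unfold tent; fun_prop, fun h => ?_, fun h hh => ?_, fun h h' => ?_⟩
  · rw [abs_of_nonneg (tent_nonneg hs h)]
    unfold tent
    refine mul_le_of_le_one_right hc (max_le zero_le_one ?_)
    have : 0 ≤ ‖h‖ / s := by positivity
    linarith
  · unfold tent
    rw [max_eq_left, mul_zero]
    have : 1 < ‖h‖ / s := by rwa [one_lt_div hs]
    linarith
  · unfold tent
    rw [← mul_sub, abs_mul, abs_of_nonneg hc, mul_assoc _ s⁻¹]
    refine mul_le_mul_of_nonneg_left ?_ hc
    rw [max_comm 0, max_comm 0]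
    refine (abs_max_sub_max_le_abs _ _ _).trans ?_
    rw [show 1 - ‖h‖ / s - (1 - ‖h'‖ / s) = s⁻¹ * (‖h'‖ - ‖h‖) by ring, abs_mul, abs_of_pos (inv_pos.2 hs), norm_sub_rev]
    exact mul_le_mul_of_nonneg_left (abs_norm_sub_norm_le _ _) (inv_pos.2 hs).le

lemma tent_integral {d : ℕ} {s : ℝ} (hs : 0 < s) : ∫ h, tent d s h = 1 := by
  have hZ := Zc_pos d
  unfold tent
  rw [integral_const_mul]
  have := Measure.integral_comp_inv_smul_of_nonneg (volume : Measure (Euc d)) (fun h => max 0 (1 - ‖h‖)) hs.le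
  simp only [norm_smul, norm_inv, Real.norm_eq_abs, abs_of_pos hs, finrank_euclideanSpace, Fintype.card_fin] at this
  simp_rw [div_eq_inv_mul, this, smul_eq_mul]
  change _ * (s ^ d * Zc d) = 1
  field_simp

lemma tent_scale {d : ℕ} {s : ℝ} (hs : 0 < s) {i : ℕ} (hi : 1 ≤ i) (h : Euc d) :
    tent d s h = (i : ℝ) ^ d * tent d (i * s) ((i : ℝ) • h) := by
  have hi' : (0:ℝ) < i := by exact_mod_cast hi
  unfold tent
  rw [norm_smul, Real.norm_natCast, mul_div_mul_left _ _ hi'.ne', mul_pow]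
  field_simp

lemma tent_cv_scale {d : ℕ} {s : ℝ} (hs : 0 < s) {i : ℕ} (hi : 1 ≤ i) (f : Euc d → ℝ) (x : Euc d) :
    ∫ h, tent d s h * f (x + (i : ℝ) • h) = cv (tent d (i * s)) f x := by
  have hi' : (0:ℝ) < i := by exact_mod_cast hi
  have := Measure.integral_comp_smul_of_nonneg (volume : Measure (Euc d)) (fun h => tent d (i * s) h * f (x + h)) (i : ℝ) (hR := hi'.le)
  simp only [finrank_euclideanSpace, Fintype.card_fin, smul_eq_mul] at this
  simp_rw [tent_scale hs hi, mul_assoc]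
  rw [integral_const_mul, this, ← mul_assoc, mul_inv_cancel₀ (by positivity), one_mul]
  rfl

def kerT (d k : ℕ) (s : ℝ) (h : Euc d) : ℝ :=
  ∑ i ∈ Finset.Icc 1 k, (-((-1 : ℝ) ^ i * (k.choose i : ℝ))) * tent d (i * s) h

def Kc (d k : ℕ) : ℝ := k * 2 ^ k * (Zc d)⁻¹

lemma ker_ker {d k : ℕ} {s : ℝ} (hs : 0 < s) :
    Ker (kerT d k s) (Kc d k * (s ^ d)⁻¹) (k * s) (Kc d k * (s ^ d)⁻¹ * s⁻¹) := by
  have hZ := Zc_pos d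
  have hcoef : ∀ i : ℕ, |(-((-1 : ℝ) ^ i * (k.choose i : ℝ)))| ≤ 2 ^ k := by
    intro i
    rw [abs_neg, abs_mul, abs_pow, abs_neg, abs_one, one_pow, one_mul, Nat.abs_cast]
    exact_mod_cast Nat.choose_le_two_pow k i
  have hsum : ∀ (g : ℕ → ℝ) (B : ℝ), 0 ≤ B → (∀ i ∈ Finset.Icc 1 k, |g i| ≤ B) →
      |∑ i ∈ Finset.Icc 1 k, (-((-1 : ℝ) ^ i * (k.choose i : ℝ))) * g i| ≤ k * 2 ^ k * B := by
    intro g B hB hg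
    refine (Finset.abs_sum_le_sum_abs _ _).trans ?_
    refine (Finset.sum_le_card_nsmul _ _ (2 ^ k * B) fun i hi => ?_).trans (le_of_eq ?_)
    · rw [abs_mul]; exact mul_le_mul (hcoef i) (hg i hi) (abs_nonneg _) (by positivity)
    · simp; ring
  have hmono : ∀ i ∈ Finset.Icc 1 k, 0 < (i : ℝ) * s ∧ s ≤ i * s ∧ (i : ℝ) * s ≤ k * s ∧ (((i : ℝ) * s) ^ d)⁻¹ ≤ (s ^ d)⁻¹ ∧ ((i : ℝ) * s)⁻¹ ≤ s⁻¹ := by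
    intro i hi
    rw [Finset.mem_Icc] at hi
    have h1 : (1:ℝ) ≤ i := by exact_mod_cast hi.1
    have h2 : (i:ℝ) ≤ k := by exact_mod_cast hi.2
    have h3 : s ≤ i * s := by nlinarith
    refine ⟨by positivity, h3, by nlinarith, ?_, ?_⟩ <;> gcongr
  refine ⟨?_, fun h => ?_, fun h hh => ?_, fun h h' => ?_⟩
  · refine continuous_finsetSum _ fun i hi => ?_
    exact ((tent_ker (hmono i hi).1).cont).const_mul _
  · refine (hsum _ ((Zc d)⁻¹ * (s ^ d)⁻¹) (by positivity) fun i hi => ?_).trans (le_of_eq (by unfold Kc; ring))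
    obtain ⟨h1, h2, h3, h4, h5⟩ := hmono i hi
    refine ((tent_ker h1).bd h).trans ?_
    gcongr
  · refine Finset.sum_eq_zero fun i hi => ?_
    obtain ⟨h1, h2, h3, h4, h5⟩ := hmono i hi
    rw [(tent_ker h1).supp h (by linarith), mul_zero]
  · unfold kerT
    rw [← Finset.sum_sub_distrib]
    simp_rw [← mul_sub]
    refine (hsum _ ((Zc d)⁻¹ * (s ^ d)⁻¹ * s⁻¹ * ‖h - h'‖) (by positivity) fun i hi => ?_).trans (le_of_eq (by unfold Kc; ring))
    obtain ⟨h1, h2, h3, h4, h5⟩ := hmono i hi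
    refine ((tent_ker h1).lip h h').trans ?_
    gcongr

def TT {d : ℕ} (k : ℕ) (s : ℝ) (f : Euc d → ℝ) : Euc d → ℝ := cv (kerT d k s) f

lemma EE_bound {d k : ℕ} {s : ℝ} (hs : 0 < s) {f : Euc d → ℝ} (hf : Nice f) (x : Euc d) :
    ‖f x - TT k s f x‖ₑ ≤ ∫⁻ h, ‖tent d s h‖ₑ * ‖iterDiff k h f x‖ₑ := by
  have hr : Finset.range (k + 1) = insert 0 (Finset.Icc 1 k) := by
    ext i; simp; omega
  have hint : ∀ i ∈ Finset.Icc 1 k, Integrable (fun h => tent d s h * f (x + (i : ℝ) • h)) := by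
    intro i hi
    have hi1 : 1 ≤ i := (Finset.mem_Icc.1 hi).1
    have hi' : (0:ℝ) < i := by exact_mod_cast hi1
    have h1 := (tent_ker (d := d) (s := i * s) (by positivity)).integrable hf x
    have h2 := (Integrable.comp_smul h1 hi'.ne').const_mul ((i : ℝ) ^ d)
    refine h2.congr (Eventually.of_forall fun h => ?_)
    simp only
    rw [tent_scale hs hi1, mul_assoc]
  have hint0 : Integrable (tent d s) := by
    refine (tent_ker hs).cont.integrable_of_hasCompactSupport ?_
    refine HasCompactSupport.intro (isCompact_closedBall (0 : Euc d) s) fun x hx => ?_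
    rw [mem_closedBall_zero_iff, not_le] at hx
    exact (tent_ker hs).supp x hx
  have key : f x - TT k s f x = ∫ h, tent d s h * ((-1 : ℝ) ^ k * iterDiff k h f x) := by
    simp_rw [iterDiff_eq', hr]
    simp_rw [Finset.sum_insert (show (0:ℕ) ∉ Finset.Icc 1 k by simp), mul_add, Finset.mul_sum]
    simp only [pow_zero, Nat.choose_zero_right, Nat.cast_one, one_mul, Nat.cast_zero, zero_smul, add_zero]
    have e : ∀ i : ℕ, (fun h => tent d s h * ((-1 : ℝ) ^ i * (k.choose i : ℝ) * f (x + (i : ℝ) • h))) =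
        fun h => ((-1 : ℝ) ^ i * (k.choose i : ℝ)) * (tent d s h * f (x + (i : ℝ) • h)) := by
      intro i; ext h; ring
    rw [integral_add, integral_finsetSum, integral_mul_const, tent_integral hs, one_mul, sub_eq_add_neg]
    · congr 1
      unfold TT cv kerT
      simp_rw [Finset.sum_mul, mul_assoc]
      rw [integral_finsetSum, ← Finset.sum_neg_distrib]
      · refine Finset.sum_congr rfl fun i hi => ?_
        have hi1 : 1 ≤ i := (Finset.mem_Icc.1 hi).1
        have := e i
        simp only [mul_assoc] at this
        rw [this, integral_const_mul, integral_const_mul, integral_const_mul, tent_cv_scale hs hi1]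
        unfold cv; ring
      · intro i hi
        have hi1 : (0:ℝ) < i := by exact_mod_cast (Finset.mem_Icc.1 hi).1
        exact ((tent_ker (by positivity)).integrable hf x).const_mul _
    · intro i hi
      rw [e i]; exact (hint i hi).const_mul _
    · exact hint0.mul_const _
    · refine integrable_finsetSum _ fun i hi => ?_
      rw [e i]; exact (hint i hi).const_mul _
  rw [key]
  refine (enorm_integral_le_lintegral_enorm _).trans (le_of_eq ?_)
  congr 1; ext h
  simp [enorm_mul, enorm_pow]



lemma vol_ball_le {d : ℕ} (x : Euc d) {r : ℝ} (hr : 0 ≤ r) :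
    volume (Metric.closedBall x r) = ENNReal.ofReal ((volume (Metric.ball (0 : Euc d) 1)).toReal * r ^ d) := by
  rw [Measure.addHaar_closedBall _ _ hr, finrank_euclideanSpace, Fintype.card_fin, mul_comm,
    ENNReal.ofReal_mul ENNReal.toReal_nonneg, ENNReal.ofReal_toReal measure_ball_lt_top.ne]

lemma vol_unit_pos (d : ℕ) : 0 < (volume (Metric.ball (0 : Euc d) 1)).toReal :=
  ENNReal.toReal_pos (Metric.measure_ball_pos _ _ one_pos).ne' measure_ball_lt_top.ne

lemma holder_ball (d : ℕ) {q : ℝ≥0∞} (hq0 : 0 < q) {p : ℝ} (hp : 1 < p) {R : ℝ} (hR : 0 < R) :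
    ∃ C : ℝ≥0∞, C ≠ ∞ ∧ ∀ (F : Euc d → ℝ) (_ : Measurable F) (x : Euc d) (s : ℝ) (_ : 0 < s),
      ∫⁻ z in Metric.closedBall x (R * s), ‖F z‖ₑ ≤
        C * ENNReal.ofReal (s ^ ((d:ℝ) - d / p)) * lorentz volume F p q (Ioi 0) := by
  obtain ⟨C, hC, h⟩ := holder_set d hq0 hp
  set V := (volume (Metric.ball (0 : Euc d) 1)).toReal
  have hV : 0 < V := vol_unit_pos d
  refine ⟨C * ENNReal.ofReal ((V * R ^ d) ^ (1 - 1 / p)), ENNReal.mul_ne_top hC (by simp), fun F hF x s hs => ?_⟩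
  refine (h F hF _ Metric.isClosed_closedBall.measurableSet (V * (R * s) ^ d) (by positivity)
    (vol_ball_le x (by positivity)).le).trans (le_of_eq ?_)
  rw [mul_assoc C _ (ENNReal.ofReal (s ^ ((d:ℝ) - d / p))), ← ENNReal.ofReal_mul (by positivity)]
  congr 3
  rw [mul_pow, ← mul_assoc, Real.mul_rpow (by positivity) (by positivity), ← Real.rpow_natCast s d,
    ← Real.rpow_mul hs.le]
  congr 2; ring

lemma nice_of {d : ℕ} {q : ℝ≥0∞} (hq0 : 0 < q) {p : ℝ} (hp : 1 < p) {f : Euc d → ℝ} (hf : Measurable f)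
    (hfin : lorentz volume f p q (Ioi 0) ≠ ∞) : Nice f := by
  refine ⟨hf, fun x r => ?_⟩
  obtain ⟨C, hC, h⟩ := holder_ball d hq0 hp one_pos
  have := h f hf x (max r 1) (by positivity)
  refine ne_top_of_le_ne_top ?_ ((lintegral_mono_set (Metric.closedBall_subset_closedBall ?_)).trans this)
  · exact ENNReal.mul_ne_top (ENNReal.mul_ne_top hC (by simp)) hfin
  · simp

lemma lint_tent {d : ℕ} {s : ℝ} (hs : 0 < s) : ∫⁻ h, ‖tent d s h‖ₑ = 1 := by
  have hint0 : Integrable (tent d s) := by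
    refine (tent_ker hs).cont.integrable_of_hasCompactSupport ?_
    refine HasCompactSupport.intro (isCompact_closedBall (0 : Euc d) s) fun x hx => ?_
    rw [mem_closedBall_zero_iff, not_le] at hx
    exact (tent_ker hs).supp x hx
  have := ofReal_integral_eq_lintegral_ofReal hint0 (Eventually.of_forall fun h => tent_nonneg hs h)
  rw [tent_integral hs, ENNReal.ofReal_one] at this
  rw [this]
  congr 1; ext h
  rw [Real.enorm_eq_ofReal (tent_nonneg hs h)]

lemma EE_lint {d k : ℕ} {s : ℝ} (hs : 0 < s) {f : Euc d → ℝ} (hf : Nice f) (E : Set (Euc d))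
    {B : ℝ≥0∞} (hB : ∀ h : Euc d, ‖h‖ ≤ s → ∫⁻ x in E, ‖iterDiff k h f x‖ₑ ≤ B) :
    ∫⁻ x in E, ‖f x - TT k s f x‖ₑ ≤ B := by
  refine (lintegral_mono fun x => EE_bound hs hf x).trans ?_
  have h1 := (tent_ker (d := d) hs).cont.measurable
  have h2 := measurable_iterDiff_param k hf.meas
  have h3 : Measurable fun z : Euc d × Euc d => iterDiff k z.2 f z.1 := h2.comp measurable_swap
  rw [lintegral_lintegral_swap]
  · have : ∀ h : Euc d, ∫⁻ x in E, ‖tent d s h‖ₑ * ‖iterDiff k h f x‖ₑ ≤ ‖tent d s h‖ₑ * B := by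
      intro h
      rw [lintegral_const_mul' _ _ (by simp)]
      by_cases hh : ‖h‖ ≤ s
      · gcongr; exact hB h hh
      · rw [(tent_ker hs).supp h (not_le.1 hh)]; simp
    refine (lintegral_mono this).trans ?_
    rw [lintegral_mul_const _ h1.enorm, lint_tent hs, one_mul]
  · refine Measurable.aemeasurable ?_
    unfold Function.uncurry
    simp only
    fun_prop

/-- the hypothesis carried around -/
def Hyp {d : ℕ} (k : ℕ) (f : Euc d → ℝ) (p : ℝ) (q : ℝ≥0∞) (t : ℝ) (K : ℝ≥0∞) : Prop :=
  ∀ s, t ≤ s → ENNReal.ofReal (s ^ (-(d : ℝ) / p)) * modulus k f p q s ≤ K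

lemma Hyp.mod {d k : ℕ} {f : Euc d → ℝ} {p : ℝ} {q : ℝ≥0∞} {t : ℝ} {K : ℝ≥0∞} (H : Hyp k f p q t K)
    (ht : 0 < t) {s : ℝ} (hs : t ≤ s) : modulus k f p q s ≤ ENNReal.ofReal (s ^ ((d : ℝ) / p)) * K := by
  have hs0 : 0 < s := ht.trans_le hs
  have := mul_le_mul_right (H s hs) (ENNReal.ofReal (s ^ ((d : ℝ) / p)))
  rwa [← mul_assoc, ← ENNReal.ofReal_mul (by positivity), ← Real.rpow_add hs0, neg_div, add_neg_cancel,
    Real.rpow_zero, ENNReal.ofReal_one, one_mul] at this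

lemma EE_ball (d : ℕ) {q : ℝ≥0∞} (hq0 : 0 < q) {p : ℝ} (hp : 1 < p) (k : ℕ) {R : ℝ} (hR : 0 < R) :
    ∃ C : ℝ≥0∞, C ≠ ∞ ∧ ∀ (f : Euc d → ℝ) (_ : Nice f) (t : ℝ) (_ : 0 < t) (K : ℝ≥0∞) (_ : Hyp k f p q t K)
      (x : Euc d) (s : ℝ) (_ : t ≤ s),
      ∫⁻ z in Metric.closedBall x (R * s), ‖f z - TT k s f z‖ₑ ≤ C * ENNReal.ofReal (s ^ d) * K := by
  obtain ⟨C, hC, h⟩ := holder_ball d hq0 hp hR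
  refine ⟨C, hC, fun f hf t ht K H x s hs => ?_⟩
  have hs0 : 0 < s := ht.trans_le hs
  refine EE_lint hs0 hf _ fun y hy => ?_
  refine (h _ (measurable_iterDiff k hf.meas y) x s hs0).trans ?_
  have h1 : lorentz volume (iterDiff k y f) p q (Ioi 0) ≤ ENNReal.ofReal (s ^ ((d : ℝ) / p)) * K :=
    le_trans (le_iSup₂ (f := fun (h : Euc d) (_ : h ∈ {h : Euc d | ‖h‖ ≤ s}) => lorentz volume (iterDiff k h f) p q (Ioi 0)) y hy) (H.mod ht hs)
  refine (mul_le_mul_right h1 _).trans (le_of_eq ?_)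
  rw [← mul_assoc, mul_assoc C, ← ENNReal.ofReal_mul (by positivity), ← Real.rpow_add hs0, sub_add_cancel, Real.rpow_natCast]

/-- (Kc s^{-d}) (C s^d K) -/
lemma cancel_pow {s : ℝ} (hs : 0 < s) (d : ℕ) {a : ℝ} (ha : 0 ≤ a) (C K : ℝ≥0∞) :
    ENNReal.ofReal (a * (s ^ d)⁻¹) * (C * ENNReal.ofReal (s ^ d) * K) = ENNReal.ofReal a * C * K := by
  have : ENNReal.ofReal (a * (s ^ d)⁻¹) * ENNReal.ofReal (s ^ d) = ENNReal.ofReal a := by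
    rw [← ENNReal.ofReal_mul (by positivity)]
    congr 1; field_simp
  rw [← this]; ring

lemma Kc_nonneg (d k : ℕ) : 0 ≤ Kc d k := by
  have := Zc_pos d
  unfold Kc; positivity

lemma TT_nice {d k : ℕ} {s : ℝ} (hs : 0 < s) {f : Euc d → ℝ} (hf : Nice f) : Nice (TT k s f) :=
  (ker_ker hs).nice hf

def GG {d : ℕ} (k : ℕ) (s : ℝ) (f : Euc d → ℝ) : Euc d → ℝ := TT k s (TT k s f)

lemma GG_diff {d k : ℕ} {s : ℝ} (hs : 0 < s) {f : Euc d → ℝ} (hf : Nice f) (x : Euc d) :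
    GG k s f x - GG k (2 * s) f x = TT k s (fun y => TT k s f y - TT k (2 * s) f y) x +
      TT k (2 * s) (fun y => TT k s f y - TT k (2 * s) f y) x := by
  have hs2 : 0 < 2 * s := by positivity
  have h1 := (ker_ker (d := d) (k := k) hs).cv_sub (TT_nice (k := k) hs hf) (TT_nice (k := k) hs2 hf) x
  have h2 := (ker_ker (d := d) (k := k) hs2).cv_sub (TT_nice (k := k) hs hf) (TT_nice (k := k) hs2 hf) x
  have h3 := (ker_ker (d := d) (k := k) hs).comm (ker_ker (d := d) (k := k) hs2) hf x
  unfold GG TT at *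
  rw [h1, h2, h3]; ring

lemma GG_step (d : ℕ) {q : ℝ≥0∞} (hq0 : 0 < q) {p : ℝ} (hp : 1 < p) (k : ℕ) {A : ℝ} (hA : 0 < A) :
    ∃ C : ℝ≥0∞, C ≠ ∞ ∧ ∀ (f : Euc d → ℝ) (_ : Nice f) (t : ℝ) (_ : 0 < t) (K : ℝ≥0∞) (_ : Hyp k f p q t K)
      (x y : Euc d) (s : ℝ) (_ : t ≤ s) (_ : ‖x - y‖ ≤ A * s),
      ‖(GG k s f x - GG k (2 * s) f x) - (GG k s f y - GG k (2 * s) f y)‖ₑ ≤ ENNReal.ofReal (‖x - y‖ / s) * (C * K) := by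
  obtain ⟨C, hC, h⟩ := EE_ball d hq0 hp k (R := 2 * k + A) (by positivity)
  refine ⟨2 * (ENNReal.ofReal (Kc d k) * (C * (1 + 2 ^ d))), ?_, fun f hf t ht K H x y s hs hxy => ?_⟩
  · have : (1 + 2 ^ d : ℝ≥0∞) ≠ ∞ := by simp
    exact ENNReal.mul_ne_top (by simp) (ENNReal.mul_ne_top (by simp) (ENNReal.mul_ne_top hC this))
  have hs0 : 0 < s := ht.trans_le hs
  have hs2 : 0 < 2 * s := by positivity
  have hZ := Kc_nonneg d k
  have hTs := TT_nice (k := k) hs0 hf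
  have hT2 := TT_nice (k := k) hs2 hf
  have hN := hTs.sub hT2
  set e := fun y => TT k s f y - TT k (2 * s) f y
  have he : ∫⁻ z in Metric.closedBall x ((2 * k + A) * s), ‖e z‖ₑ ≤ (C * (1 + 2 ^ d)) * ENNReal.ofReal (s ^ d) * K := by
    have h1 := h f hf t ht K H x s hs
    have h2 := h f hf t ht K H x (2 * s) (by linarith)
    have h3 : ∫⁻ z in Metric.closedBall x ((2 * k + A) * s), ‖f z - TT k (2 * s) f z‖ₑ ≤ C * ENNReal.ofReal ((2 * s) ^ d) * K := by
      refine (lintegral_mono_set (Metric.closedBall_subset_closedBall ?_)).trans h2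
      gcongr; linarith
    have h4 : ∫⁻ z in Metric.closedBall x ((2 * k + A) * s), ‖e z‖ₑ ≤
        ∫⁻ z in Metric.closedBall x ((2 * k + A) * s), (‖f z - TT k s f z‖ₑ + ‖f z - TT k (2 * s) f z‖ₑ) := by
      refine lintegral_mono fun z => ?_
      have : e z = (f z - TT k (2 * s) f z) - (f z - TT k s f z) := by simp [e]
      rw [this, add_comm]
      exact enorm_sub_le
    refine h4.trans ?_
    rw [lintegral_add_left (hf.sub hTs).meas.enorm]
    refine (add_le_add h1 h3).trans (le_of_eq ?_)
    rw [mul_pow, ENNReal.ofReal_mul (by positivity), ENNReal.ofReal_pow (show (0:ℝ) ≤ 2 by norm_num) d, ENNReal.ofReal_ofNat]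
    ring
  have key : ∀ σ, s ≤ σ → σ ≤ 2 * s → ‖TT k σ e x - TT k σ e y‖ₑ ≤
      ENNReal.ofReal (‖x - y‖ / s) * (ENNReal.ofReal (Kc d k) * (C * (1 + 2 ^ d)) * K) := by
    intro σ h1 h2
    have hσ : 0 < σ := by linarith
    refine ((ker_ker hσ).enorm_cv_sub_le hN x y).trans ?_
    have hb : ∫⁻ z in Metric.closedBall x (k * σ + ‖x - y‖), ‖e z‖ₑ ≤ (C * (1 + 2 ^ d)) * ENNReal.ofReal (s ^ d) * K := by
      refine (lintegral_mono_set (Metric.closedBall_subset_closedBall ?_)).trans he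
      have : (k:ℝ) * σ ≤ k * (2 * s) := by gcongr
      linarith
    rw [← cancel_pow hs0 d hZ, ← mul_assoc, ← ENNReal.ofReal_mul (by positivity)]
    refine mul_le_mul' (ENNReal.ofReal_le_ofReal ?_) hb
    have h5 : (σ ^ d)⁻¹ ≤ (s ^ d)⁻¹ := by gcongr
    have h6 : σ⁻¹ ≤ s⁻¹ := by gcongr
    calc Kc d k * (σ ^ d)⁻¹ * σ⁻¹ * ‖x - y‖ ≤ Kc d k * (s ^ d)⁻¹ * s⁻¹ * ‖x - y‖ := by gcongr
      _ = _ := by ring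
  rw [GG_diff hs0 hf, GG_diff hs0 hf, add_sub_add_comm]
  refine (enorm_add_le _ _).trans ?_
  refine (add_le_add (key s le_rfl (by linarith)) (key (2 * s) (by linarith) le_rfl)).trans (le_of_eq ?_)
  ring

lemma GG_decay (d : ℕ) {q : ℝ≥0∞} (hq0 : 0 < q) {p : ℝ} (hp : 1 < p) {k : ℕ} (hk : 0 < k) :
    ∃ C : ℝ≥0∞, C ≠ ∞ ∧ ∀ (f : Euc d → ℝ) (_ : Nice f) (x : Euc d) (s : ℝ) (_ : 0 < s),
      ‖GG k s f x‖ₑ ≤ C * ENNReal.ofReal (s ^ (-(d : ℝ) / p)) * lorentz volume f p q (Ioi 0) := by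
  have hk' : (0:ℝ) < k := by exact_mod_cast hk
  obtain ⟨C, hC, h⟩ := holder_ball d hq0 hp (R := 2 * k) (by positivity)
  set V := (volume (Metric.ball (0 : Euc d) 1)).toReal
  have hV : 0 < V := vol_unit_pos d
  have hZ := Kc_nonneg d k
  refine ⟨ENNReal.ofReal (Kc d k * Kc d k * V * k ^ d) * C, ENNReal.mul_ne_top (by simp) hC, fun f hf x s hs => ?_⟩
  refine ((ker_ker hs).enorm_cv_le _ x).trans ?_
  have h1 : ∫⁻ z in Metric.closedBall x (k * s), ‖TT k s f z‖ₑ ≤ ∫⁻ z in Metric.closedBall x (k * s),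
      (ENNReal.ofReal (Kc d k * (s ^ d)⁻¹) * ∫⁻ z in Metric.closedBall x (2 * k * s), ‖f z‖ₑ) := by
    refine setLIntegral_mono' Metric.isClosed_closedBall.measurableSet fun z hz => ?_
    refine ((ker_ker hs).enorm_cv_le _ z).trans ?_
    gcongr 1
    refine lintegral_mono_set (Metric.closedBall_subset_closedBall' ?_)
    rw [Metric.mem_closedBall] at hz
    linarith
  rw [setLIntegral_const, vol_ball_le x (by positivity)] at h1
  refine (mul_le_mul_right (h1.trans (mul_le_mul_left (mul_le_mul_right (h f hf.meas x s hs) _) _)) _).trans (le_of_eq ?_)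
  have e : Kc d k * Kc d k * V * k ^ d * s ^ (-(d : ℝ) / p) = (Kc d k * (s ^ d)⁻¹) * ((Kc d k * (s ^ d)⁻¹) * (V * (k * s) ^ d) * s ^ ((d:ℝ) - d / p)) := by
    rw [sub_eq_add_neg, Real.rpow_add hs, Real.rpow_natCast, mul_pow, neg_div]
    field_simp
  rw [mul_right_comm _ C, ← ENNReal.ofReal_mul (by positivity), e]
  change _ * (_ * _ * ENNReal.ofReal (V * (k * s) ^ d)) = _
  have ha : 0 ≤ Kc d k * (s ^ d)⁻¹ := by positivity
  have hb : 0 ≤ V * (k * s) ^ d := by positivity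
  generalize Kc d k * (s ^ d)⁻¹ = a at *
  generalize V * (k * s) ^ d = b at *
  rw [ENNReal.ofReal_mul ha, ENNReal.ofReal_mul (mul_nonneg ha hb), ENNReal.ofReal_mul ha]
  ring

lemma TT_osc (d : ℕ) (hd : 0 < d) {q : ℝ≥0∞} (hq0 : 0 < q) {p : ℝ} (hp : 1 < p) {k : ℕ} (hk : 0 < k) {A : ℝ} (hA : 0 < A) :
    ∃ C : ℝ≥0∞, C ≠ ∞ ∧ ∀ (f : Euc d → ℝ) (_ : Measurable f) (_ : lorentz volume f p q (Ioi 0) ≠ ∞)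
      (t : ℝ) (_ : 0 < t) (K : ℝ≥0∞) (_ : Hyp k f p q t K)
      (x y : Euc d) (l : ℝ) (_ : t ≤ l) (_ : ‖x - y‖ ≤ A * l), ‖TT k l f x - TT k l f y‖ₑ ≤ C * K := by
  have hk' : (0:ℝ) < k := by exact_mod_cast hk
  have hd' : (0:ℝ) < d := by exact_mod_cast hd
  obtain ⟨C1, hC1, h1⟩ := EE_ball d hq0 hp k (R := k) hk'
  obtain ⟨C2, hC2, h2⟩ := GG_step d hq0 hp k hA
  obtain ⟨C3, hC3, h3⟩ := GG_decay d hq0 hp hk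
  refine ⟨2 * (ENNReal.ofReal (Kc d k) * C1) + ENNReal.ofReal A * C2 * 2, ?_, fun f hf hfin t ht K H x y l hl hxy => ?_⟩
  · exact ENNReal.add_ne_top.2 ⟨ENNReal.mul_ne_top (by simp) (ENNReal.mul_ne_top (by simp) hC1), ENNReal.mul_ne_top (ENNReal.mul_ne_top (by simp) hC2) (by simp)⟩
  have hN := nice_of hq0 hp hf hfin
  have hl0 : 0 < l := ht.trans_le hl
  have hT := TT_nice (k := k) hl0 hN
  have a1 : ∀ z, ‖TT k l f z - GG k l f z‖ₑ ≤ ENNReal.ofReal (Kc d k) * C1 * K := by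
    intro z
    have e := (ker_ker (d := d) (k := k) hl0).cv_sub hN hT z
    have : TT k l f z - GG k l f z = cv (kerT d k l) (fun y => f y - TT k l f y) z := e.symm
    rw [this, ← cancel_pow hl0 d (Kc_nonneg d k)]
    exact ((ker_ker hl0).enorm_cv_le _ z).trans (mul_le_mul_right (h1 f hN t ht K H z l hl) _)
  have a2 : ∀ N : ℕ, ‖(GG k l f x - GG k (2 ^ N * l) f x) - (GG k l f y - GG k (2 ^ N * l) f y)‖ₑ ≤
      ∑ j ∈ Finset.range N, ENNReal.ofReal A * C2 * K * 2⁻¹ ^ j := by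
    intro N
    induction N with
    | zero => simp
    | succ N ih =>
      rw [Finset.sum_range_succ]
      have hN1 : (1:ℝ) ≤ 2 ^ N := one_le_pow₀ (by norm_num)
      have hle : l ≤ 2 ^ N * l := by nlinarith
      have := h2 f hN t ht K H x y (2 ^ N * l) (by linarith) (by nlinarith)
      rw [← mul_assoc 2, ← pow_succ'] at this
      have e : (GG k l f x - GG k (2 ^ (N + 1) * l) f x) - (GG k l f y - GG k (2 ^ (N + 1) * l) f y) =
        ((GG k l f x - GG k (2 ^ N * l) f x) - (GG k l f y - GG k (2 ^ N * l) f y)) +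
        ((GG k (2 ^ N * l) f x - GG k (2 ^ (N + 1) * l) f x) - (GG k (2 ^ N * l) f y - GG k (2 ^ (N + 1) * l) f y)) := by ring
      rw [e]
      refine (enorm_add_le _ _).trans (add_le_add ih (this.trans ?_))
      have e2 : ENNReal.ofReal (‖x - y‖ / (2 ^ N * l)) ≤ ENNReal.ofReal A * 2⁻¹ ^ N := by
        have : (2⁻¹ : ℝ≥0∞) ^ N = ENNReal.ofReal (2⁻¹ ^ N) := by
          rw [ENNReal.ofReal_pow (by norm_num), ENNReal.ofReal_inv_of_pos (by norm_num), ENNReal.ofReal_ofNat]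
        rw [this, ← ENNReal.ofReal_mul hA.le]
        refine ENNReal.ofReal_le_ofReal ?_
        rw [div_le_iff₀ (by positivity)]
        refine hxy.trans (le_of_eq ?_)
        rw [inv_pow]; field_simp
      refine (mul_le_mul_left e2 _).trans (le_of_eq ?_)
      ring
  have a3 : ∀ N : ℕ, ‖TT k l f x - TT k l f y‖ₑ ≤ (2 * (ENNReal.ofReal (Kc d k) * C1) + ENNReal.ofReal A * C2 * 2) * K +
      2 * (C3 * ENNReal.ofReal ((2 ^ N * l) ^ (-(d : ℝ) / p)) * lorentz volume f p q (Ioi 0)) := by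
    intro N
    have e : TT k l f x - TT k l f y = (TT k l f x - GG k l f x) - (TT k l f y - GG k l f y) +
      ((GG k l f x - GG k (2 ^ N * l) f x) - (GG k l f y - GG k (2 ^ N * l) f y)) + (GG k (2 ^ N * l) f x - GG k (2 ^ N * l) f y) := by ring
    have b1 : ‖(TT k l f x - GG k l f x) - (TT k l f y - GG k l f y)‖ₑ ≤ 2 * (ENNReal.ofReal (Kc d k) * C1 * K) := by
      rw [two_mul]; exact enorm_sub_le.trans (add_le_add (a1 x) (a1 y))
    have b2 : ‖GG k (2 ^ N * l) f x - GG k (2 ^ N * l) f y‖ₑ ≤ 2 * (C3 * ENNReal.ofReal ((2 ^ N * l) ^ (-(d : ℝ) / p)) * lorentz volume f p q (Ioi 0)) := by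
      rw [two_mul]; exact enorm_sub_le.trans (add_le_add (h3 f hN x _ (by positivity)) (h3 f hN y _ (by positivity)))
    have b3 : ∑ j ∈ Finset.range N, ENNReal.ofReal A * C2 * K * 2⁻¹ ^ j ≤ ENNReal.ofReal A * C2 * K * 2 := by
      rw [← Finset.mul_sum]
      gcongr
      refine (ENNReal.sum_le_tsum _).trans ?_
      rw [ENNReal.tsum_geometric, ENNReal.one_sub_inv_two, inv_inv]
    rw [e]
    refine (enorm_add_le _ _).trans (add_le_add ((enorm_add_le _ _).trans (add_le_add b1 ((a2 N).trans b3))) b2) |>.trans (le_of_eq ?_)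
    ring
  have lim : Tendsto (fun N : ℕ => (2 * (ENNReal.ofReal (Kc d k) * C1) + ENNReal.ofReal A * C2 * 2) * K +
      2 * (C3 * ENNReal.ofReal ((2 ^ N * l) ^ (-(d : ℝ) / p)) * lorentz volume f p q (Ioi 0))) atTop
      (nhds ((2 * (ENNReal.ofReal (Kc d k) * C1) + ENNReal.ofReal A * C2 * 2) * K + 2 * (C3 * ENNReal.ofReal 0 * lorentz volume f p q (Ioi 0)))) := by
    have r : Tendsto (fun N : ℕ => ((2:ℝ) ^ N * l) ^ (-(d : ℝ) / p)) atTop (nhds 0) := by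
      have r1 : Tendsto (fun N : ℕ => (2:ℝ) ^ N * l) atTop atTop :=
        (tendsto_pow_atTop_atTop_of_one_lt (by norm_num)).atTop_mul_const hl0
      have r2 := tendsto_rpow_neg_atTop (show (0:ℝ) < d / p by positivity)
      rw [neg_div]
      exact r2.comp r1
    have r' := ENNReal.tendsto_ofReal r
    refine Tendsto.const_add _ ?_
    refine ENNReal.Tendsto.const_mul ?_ (Or.inr (by simp))
    refine ENNReal.Tendsto.mul_const ?_ (Or.inr hfin)
    exact ENNReal.Tendsto.const_mul r' (Or.inr hC3)
  have := ge_of_tendsto' lim a3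
  simpa using this



lemma avg_dec {Ψ : ℝ → ℝ≥0∞} (hΨ : Antitone Ψ) {n m : ℝ} (hn : 0 < n) (hnm : n ≤ m) :
    ∫⁻ v in Ioo 0 m, Ψ v ≤ ENNReal.ofReal (m / n) * ∫⁻ v in Ioo 0 n, Ψ v := by
  have hm : 0 < m := hn.trans_le hnm
  have hc : 0 < m / n := by positivity
  have hc1 : 1 ≤ m / n := by rwa [one_le_div hn]
  have h := lintegral_smul_eq (volume : Measure ℝ) ((Ioo 0 m).indicator Ψ) hc
  simp only [smul_eq_mul, Module.finrank_self, pow_one] at h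
  rw [lintegral_indicator measurableSet_Ioo] at h
  have h1 : ∫⁻ v in Ioo 0 m, Ψ v = ENNReal.ofReal (m / n) * ∫⁻ x, (Ioo 0 m).indicator Ψ (m / n * x) := by
    rw [h, ← mul_assoc, ← ENNReal.ofReal_mul hc.le, mul_inv_cancel₀ hc.ne', ENNReal.ofReal_one, one_mul]
  rw [h1, ← lintegral_indicator measurableSet_Ioo]
  gcongr with x
  by_cases hx : m / n * x ∈ Ioo 0 m
  · have hx0 : 0 < x := pos_of_mul_pos_right hx.1 hc.le
    have hxn : x < n := by
      have := hx.2
      rw [div_mul_eq_mul_div, div_lt_iff₀ hn] at this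
      exact lt_of_mul_lt_mul_left this hm.le
    rw [indicator_of_mem hx, indicator_of_mem (show x ∈ Ioo 0 n from ⟨hx0, hxn⟩)]
    exact hΨ (by nlinarith)
  · rw [indicator_of_notMem hx]; exact bot_le

lemma cube_eq {d : ℕ} (a : Fin d → ℝ) (l : ℝ) :
    cubeSet a l = (@WithLp.ofLp 2 (Fin d → ℝ)) ⁻¹' (Icc a (fun i => a i + l)) := by
  ext x
  simp only [cubeSet, mem_ofPred_eq, mem_preimage, mem_Icc, Pi.le_def, forall_and]

lemma cube_meas {d : ℕ} (a : Fin d → ℝ) (l : ℝ) : MeasurableSet (cubeSet a l) := by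
  rw [cube_eq]
  exact (PiLp.volume_preserving_ofLp (Fin d)).measurable measurableSet_Icc

lemma cube_vol {d : ℕ} (a : Fin d → ℝ) {l : ℝ} (hl : 0 ≤ l) : volume (cubeSet a l) = ENNReal.ofReal (l ^ d) := by
  rw [cube_eq, (PiLp.volume_preserving_ofLp (Fin d)).measure_preimage measurableSet_Icc.nullMeasurableSet, Real.volume_Icc_pi]
  simp [ENNReal.ofReal_pow hl]

lemma cube_sub {d : ℕ} {a : Fin d → ℝ} {l : ℝ} (hl : 0 ≤ l) {x y : Euc d} (hx : x ∈ cubeSet a l) (hy : y ∈ cubeSet a l) :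
    ‖x - y‖ ≤ √d * l := by
  rw [EuclideanSpace.norm_eq]
  refine Real.sqrt_le_iff.2 ⟨by positivity, ?_⟩
  rw [mul_pow, Real.sq_sqrt (by positivity)]
  refine (Finset.sum_le_card_nsmul _ _ (l ^ 2) fun i _ => ?_).trans (by simp)
  rw [Real.norm_eq_abs]
  refine pow_le_pow_left₀ (abs_nonneg _) ?_ 2
  have h1 := hx i
  have h2 := hy i
  rw [PiLp.sub_apply, abs_le]
  constructor <;> linarith [h1.1, h1.2, h2.1, h2.2]

lemma osc_le {d : ℕ} {f : Euc d → ℝ} (hf : Nice f) (a : Fin d → ℝ) {l : ℝ} (hl : 0 < l) (c : ℝ) :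
    ENNReal.ofReal (⨍ y in cubeSet a l, |f y - ⨍ z in cubeSet a l, f z|) ≤
      2 * (ENNReal.ofReal (l ^ d))⁻¹ * ∫⁻ z in cubeSet a l, ‖f z - c‖ₑ := by
  set Q := cubeSet a l
  have hQ : MeasurableSet Q := cube_meas a l
  have hv : volume Q = ENNReal.ofReal (l ^ d) := cube_vol a hl.le
  have hv0 : volume Q ≠ 0 := by rw [hv]; simp; positivity
  have hvt : volume Q ≠ ∞ := by rw [hv]; simp
  have hfm := hf.meas
  have hint : IntegrableOn f Q := by
    refine ⟨hfm.aestronglyMeasurable, ?_⟩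
    by_cases hne : Q.Nonempty
    · obtain ⟨x, hx⟩ := hne
      refine lt_of_le_of_lt (lintegral_mono_set (t := Metric.closedBall x (√d * l)) fun y hy => ?_) (hf.fin _ _).lt_top
      rw [Metric.mem_closedBall, dist_eq_norm]
      exact cube_sub hl.le hy hx
    · rw [not_nonempty_iff_eq_empty.1 hne]; simp [HasFiniteIntegral]
  have hcon : ∀ c : ℝ, IntegrableOn (fun _ : Euc d => c) Q := fun c => integrableOn_const hvt
  set m := ⨍ z in Q, f z with hm
  rw [ofReal_setAverage (f := fun y => |f y - m|) (hint.sub (hcon m)).abs (Eventually.of_forall fun y => abs_nonneg _)]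
  simp_rw [← Real.enorm_eq_ofReal_abs]
  have h1 : ‖c - m‖ₑ * volume Q ≤ ∫⁻ z in Q, ‖f z - c‖ₑ := by
    have h2 := enorm_integral_le_lintegral_enorm (μ := volume.restrict Q) (fun z => f z - c)
    refine le_trans (le_of_eq ?_) h2
    rw [integral_sub hint (hcon c), setIntegral_const, smul_eq_mul]
    have h3 : ∫ z in Q, f z = volume.real Q * m := by
      rw [hm, setAverage_eq, smul_eq_mul, ← mul_assoc, mul_inv_cancel₀, one_mul]
      rw [measureReal_def]; exact ENNReal.toReal_ne_zero.2 ⟨hv0, hvt⟩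
    rw [h3, ← mul_sub, enorm_mul, mul_comm, enorm_sub_rev]
    congr 1
    rw [measureReal_def, Real.enorm_eq_ofReal ENNReal.toReal_nonneg, ENNReal.ofReal_toReal hvt]
  have h2 : ∫⁻ z in Q, ‖f z - m‖ₑ ≤ ∫⁻ z in Q, (‖f z - c‖ₑ + ‖c - m‖ₑ) := by
    refine lintegral_mono fun z => ?_
    rw [← sub_add_sub_cancel (f z) c m]
    exact enorm_add_le _ _
  rw [lintegral_add_right _ measurable_const, setLIntegral_const] at h2
  rw [← hv, ENNReal.div_eq_inv_mul]
  refine (mul_le_mul_right (h2.trans (add_le_add le_rfl h1)) _).trans (le_of_eq ?_)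
  ring

lemma osc_le2 {d : ℕ} {f g : Euc d → ℝ} (hf : Nice f) (a : Fin d → ℝ) {l : ℝ} (hl : 0 < l)
    {x : Euc d} (hx : x ∈ cubeSet a l) {B : ℝ≥0∞} (hB : ∀ y, ‖x - y‖ ≤ √d * l → ‖g x - g y‖ₑ ≤ B) :
    ENNReal.ofReal (⨍ y in cubeSet a l, |f y - ⨍ z in cubeSet a l, f z|) ≤
      2 * B + 2 * (ENNReal.ofReal (l ^ d))⁻¹ * ∫⁻ z in Metric.closedBall x (√d * l), ‖f z - g z‖ₑ := by
  have hv := cube_vol a hl.le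
  have hv0 : volume (cubeSet a l) ≠ 0 := by rw [hv]; simp; positivity
  have hvt : volume (cubeSet a l) ≠ ∞ := by rw [hv]; simp
  refine (osc_le hf a hl (g x)).trans ?_
  have h1 : ∫⁻ z in cubeSet a l, ‖f z - g x‖ₑ ≤ ∫⁻ z in cubeSet a l, (‖f z - g z‖ₑ + B) := by
    refine setLIntegral_mono' (cube_meas a l) fun z hz => ?_
    rw [← sub_add_sub_cancel (f z) (g z) (g x)]
    refine (enorm_add_le _ _).trans (add_le_add le_rfl ?_)
    rw [enorm_sub_rev]
    exact hB z (cube_sub hl.le hx hz)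
  rw [lintegral_add_right _ measurable_const, setLIntegral_const] at h1
  have h2 : ∫⁻ z in cubeSet a l, ‖f z - g z‖ₑ ≤ ∫⁻ z in Metric.closedBall x (√d * l), ‖f z - g z‖ₑ := by
    refine lintegral_mono_set fun y hy => ?_
    rw [Metric.mem_closedBall, dist_eq_norm]
    exact cube_sub hl.le hy hx
  refine (mul_le_mul_right (h1.trans (add_le_add h2 le_rfl)) _).trans (le_of_eq ?_)
  rw [mul_add, add_comm, ← hv]
  congr 1
  rw [mul_comm B, mul_assoc, ← mul_assoc _ _ B, ENNReal.inv_mul_cancel hv0 hvt, one_mul]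

lemma sharp_point (d : ℕ) (hd : 0 < d) {q : ℝ≥0∞} (hq0 : 0 < q) {p : ℝ} (hp : 1 < p) {k : ℕ} (hk : 0 < k) :
    ∃ C : ℝ≥0∞, C ≠ ∞ ∧ ∀ (f : Euc d → ℝ) (_ : Measurable f) (_ : lorentz volume f p q (Ioi 0) ≠ ∞)
      (t : ℝ) (_ : 0 < t) (K : ℝ≥0∞) (_ : Hyp k f p q t K) (x : Euc d) (b : ℝ≥0∞) (_ : C * K + b < sharp f x),
      ∃ l, 0 < l ∧ l ≤ t ∧ b < 2 * (ENNReal.ofReal (l ^ d))⁻¹ * ∫⁻ z in Metric.closedBall x (√d * l), ‖f z - TT k t f z‖ₑ := by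
  have hd' : (0:ℝ) < d := by exact_mod_cast hd
  have hA : 0 < √(d:ℝ) := by positivity
  obtain ⟨C1, hC1, h1⟩ := EE_ball d hq0 hp k (R := √d) hA
  obtain ⟨C2, hC2, h2⟩ := TT_osc d hd hq0 hp hk hA
  refine ⟨2 * C2 + 2 * C1, ?_, fun f hf hfin t ht K H x b hb => ?_⟩
  · exact ENNReal.add_ne_top.2 ⟨ENNReal.mul_ne_top (by simp) hC2, ENNReal.mul_ne_top (by simp) hC1⟩
  have hN := nice_of hq0 hp hf hfin
  unfold sharp at hb
  simp only [lt_iSup_iff] at hb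
  obtain ⟨Q, ⟨⟨a, l, hl, rfl⟩, hx⟩, hb⟩ := hb
  rcases le_total t l with htl | htl
  · exfalso
    have := osc_le2 hN (g := TT k l f) a hl hx (B := C2 * K) fun y hy => h2 f hf hfin t ht K H x y l htl hy
    have h3 := this.trans (add_le_add le_rfl (mul_le_mul_right (h1 f hN t ht K H x l htl) _))
    refine (hb.trans_le h3).not_ge (le_trans (le_of_eq ?_) le_self_add)
    rw [add_mul]
    have e : (ENNReal.ofReal (l ^ d))⁻¹ * ENNReal.ofReal (l ^ d) = 1 :=
      ENNReal.inv_mul_cancel (by simp; positivity) (by simp)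
    calc 2 * (C2 * K) + 2 * (ENNReal.ofReal (l ^ d))⁻¹ * (C1 * ENNReal.ofReal (l ^ d) * K)
        = 2 * C2 * K + 2 * C1 * K * ((ENNReal.ofReal (l ^ d))⁻¹ * ENNReal.ofReal (l ^ d)) := by ring
      _ = _ := by rw [e, mul_one]
  · refine ⟨l, hl, htl, ?_⟩
    have := osc_le2 hN (g := TT k t f) a hl hx (B := C2 * K) fun y hy =>
      h2 f hf hfin t ht K H x y t le_rfl (hy.trans (by gcongr))
    have h3 := hb.trans_le this
    by_contra hcon
    rw [not_lt] at hcon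
    refine h3.not_ge (add_le_add ?_ hcon)
    rw [← mul_assoc]
    exact mul_le_mul_left le_self_add _

lemma vitali_sel {d : ℕ} (S : Set (Euc d)) (r : Euc d → ℝ) {R : ℝ} (h0 : ∀ x ∈ S, 0 < r x) (hR : ∀ x ∈ S, r x ≤ R)
    {a : ℝ≥0∞} (ha : a < volume S) :
    ∃ s : Finset (Euc d), (∀ x ∈ s, x ∈ S) ∧ (s : Set (Euc d)).PairwiseDisjoint (fun x => Metric.closedBall x (r x)) ∧
      a < 5 ^ d * ∑ x ∈ s, volume (Metric.closedBall x (r x)) := by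
  obtain ⟨u, huS, hdis, hcov⟩ := Vitali.exists_disjoint_subfamily_covering_enlargement_closedBall S id r R hR 5 (by norm_num)
  simp only [id] at hdis hcov
  have huc : u.Countable := hdis.countable_of_nonempty_interior fun x hx =>
    ⟨x, Metric.ball_subset_interior_closedBall (Metric.mem_ball_self (h0 x (huS hx)))⟩
  have h1 : volume S ≤ volume (⋃ x ∈ u, Metric.closedBall x (5 * r x)) := by
    refine measure_mono fun x hx => ?_
    obtain ⟨b, hb, hsub⟩ := hcov x hx
    exact mem_iUnion₂.2 ⟨b, hb, hsub (Metric.mem_closedBall_self (h0 x hx).le)⟩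
  have h2 := h1.trans (measure_biUnion_le volume huc _)
  have h3 : ∑' x : u, volume (Metric.closedBall (x : Euc d) (5 * r x)) = 5 ^ d * ∑' x : u, volume (Metric.closedBall (x : Euc d) (r x)) := by
    rw [← ENNReal.tsum_mul_left]
    congr 1; ext x
    have := (h0 x (huS x.2)).le
    rw [vol_ball_le _ (by positivity), vol_ball_le _ this, mul_pow, mul_left_comm, ENNReal.ofReal_mul (by positivity),
      ENNReal.ofReal_pow (by norm_num), ENNReal.ofReal_ofNat]
  rw [h3, ENNReal.tsum_eq_iSup_sum, ENNReal.mul_iSup] at h2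
  obtain ⟨s, hs⟩ := lt_iSup_iff.1 (ha.trans_le h2)
  refine ⟨s.map (Function.Embedding.subtype _), ?_, ?_, ?_⟩
  · intro x hx
    simp only [Finset.mem_map, Function.Embedding.subtype_apply] at hx
    obtain ⟨y, -, rfl⟩ := hx
    exact huS y.2
  · refine hdis.subset ?_
    intro x hx
    simp only [Finset.coe_map, Function.Embedding.subtype_apply] at hx
    obtain ⟨y, -, rfl⟩ := hx
    exact y.2
  · rwa [Finset.sum_map]

lemma rearr_sharp (d : ℕ) (hd : 0 < d) {q : ℝ≥0∞} (hq0 : 0 < q) {p : ℝ} (hp : 1 < p) {k : ℕ} (hk : 0 < k) :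
    ∃ C C' : ℝ≥0∞, C ≠ ∞ ∧ C' ≠ ∞ ∧ ∀ (f : Euc d → ℝ) (_ : Measurable f) (_ : lorentz volume f p q (Ioi 0) ≠ ∞)
      (t : ℝ) (_ : 0 < t) (K : ℝ≥0∞) (_ : Hyp k f p q t K) (u : ℝ) (_ : 0 < u),
      rearr volume (sharp f) u ≤ C * K + C' * ((ENNReal.ofReal u)⁻¹ * ∫⁻ v in Ioo 0 u, Psi k f t v) := by
  have hd' : (0:ℝ) < d := by exact_mod_cast hd
  have hA : 0 < √(d:ℝ) := by positivity
  obtain ⟨C, hC, h⟩ := sharp_point d hd hq0 hp hk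
  set V := (volume (Metric.ball (0 : Euc d) 1)).toReal
  have hV : 0 < V := vol_unit_pos d
  set c := 2 * ENNReal.ofReal (V * √d ^ d) with hc
  have hct : c ≠ ∞ := ENNReal.mul_ne_top (by simp) (by simp)
  refine ⟨C, c * 5 ^ d, hC, ENNReal.mul_ne_top hct (by simp), fun f hf hfin t ht K H u hu => ?_⟩
  have hN := nice_of hq0 hp hf hfin
  refine rearr_le_of _ _ _ ?_
  set b := c * 5 ^ d * ((ENNReal.ofReal u)⁻¹ * ∫⁻ v in Ioo 0 u, Psi k f t v) with hb
  by_contra hcon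
  rw [not_le] at hcon
  set S := {x | C * K + b < sharp f x}
  have hS : ∀ x : Euc d, ∃ l, x ∈ S → 0 < l ∧ l ≤ t ∧ b < 2 * (ENNReal.ofReal (l ^ d))⁻¹ * ∫⁻ z in Metric.closedBall x (√d * l), ‖f z - TT k t f z‖ₑ := by
    intro x
    by_cases hx : x ∈ S
    · obtain ⟨l, hl⟩ := h f hf hfin t ht K H x b hx
      exact ⟨l, fun _ => hl⟩
    · exact ⟨0, fun h => absurd h hx⟩
  choose l hl using hS
  obtain ⟨s, hsS, hdis, hlt⟩ := vitali_sel S (fun x => √d * l x) (R := √d * t)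
    (fun x hx => mul_pos hA (hl x hx).1) (fun x hx => by have := (hl x hx).2.1; gcongr) hcon
  have hball : ∀ x ∈ s, b * volume (Metric.closedBall x (√d * l x)) < c * ∫⁻ z in Metric.closedBall x (√d * l x), ‖f z - TT k t f z‖ₑ := by
    intro x hx
    obtain ⟨h1, -, h2⟩ := hl x (hsS x hx)
    have hv0 : volume (Metric.closedBall x (√d * l x)) ≠ 0 := (Metric.measure_closedBall_pos _ _ (by positivity)).ne'
    have hvt : volume (Metric.closedBall x (√d * l x)) ≠ ∞ := measure_closedBall_lt_top.ne
    have e : c = 2 * (ENNReal.ofReal (l x ^ d))⁻¹ * volume (Metric.closedBall x (√d * l x)) := by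
      rw [vol_ball_le _ (by positivity), mul_pow, ← mul_assoc, ENNReal.ofReal_mul (by positivity), mul_comm (ENNReal.ofReal _) (ENNReal.ofReal (l x ^ d)),
        mul_assoc, ← mul_assoc _ (ENNReal.ofReal (l x ^ d)), ENNReal.inv_mul_cancel (by simp; positivity) (by simp), one_mul]
    rw [e, mul_right_comm _ (volume _) (lintegral _ _)]
    exact (ENNReal.mul_lt_mul_iff_left hv0 hvt).2 h2
  have hne : s.Nonempty := by
    rw [Finset.nonempty_iff_ne_empty]
    rintro rfl
    simp at hlt
  have hsum := ENNReal.sum_lt_sum_of_nonempty hne hball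
  rw [← Finset.mul_sum, ← Finset.mul_sum] at hsum
  set E := ⋃ x ∈ s, Metric.closedBall x (√d * l x) with hE
  have hEm : MeasurableSet E := s.measurableSet_biUnion fun x _ => Metric.isClosed_closedBall.measurableSet
  have hvE : volume E = ∑ x ∈ s, volume (Metric.closedBall x (√d * l x)) :=
    measure_biUnion_finset hdis fun x _ => Metric.isClosed_closedBall.measurableSet
  have hvEt : volume E ≠ ∞ := by
    rw [hvE]; exact (ENNReal.sum_lt_top.2 fun x _ => measure_closedBall_lt_top).ne
  have hIE : ∫⁻ z in E, ‖f z - TT k t f z‖ₑ = ∑ x ∈ s, ∫⁻ z in Metric.closedBall x (√d * l x), ‖f z - TT k t f z‖ₑ :=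
    lintegral_biUnion_finset hdis (fun x _ => Metric.isClosed_closedBall.measurableSet) _
  rw [← hvE, ← hIE] at hsum
  rw [← hvE] at hlt
  set m := (volume E).toReal with hm
  have hmE : volume E = ENNReal.ofReal m := (ENNReal.ofReal_toReal hvEt).symm
  have hmu : u / 5 ^ d ≤ m := by
    rw [hmE, show (5 ^ d : ℝ≥0∞) = ENNReal.ofReal (5 ^ d) by rw [ENNReal.ofReal_pow (by norm_num), ENNReal.ofReal_ofNat],
      ← ENNReal.ofReal_mul (by positivity)] at hlt
    have := (ENNReal.ofReal_lt_ofReal_iff_of_nonneg hu.le).1 hlt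
    rw [div_le_iff₀ (by positivity)]
    linarith
  have hmpos : 0 < m := lt_of_lt_of_le (by positivity) hmu
  have hint : ∫⁻ z in E, ‖f z - TT k t f z‖ₑ ≤ ∫⁻ v in Ioo 0 m, Psi k f t v := by
    refine EE_lint ht hN E fun y hy => ?_
    simp_rw [Real.enorm_eq_ofReal_abs]
    have hmeas := measurable_iterDiff k hf y
    refine (setLIntegral_le_rearr (by fun_prop) hEm hmE.le).trans (lintegral_mono fun v => ?_)
    exact le_iSup₂ (f := fun (h : Euc d) (_ : h ∈ {h : Euc d | ‖h‖ ≤ t}) => rearrR volume (iterDiff k h f) v) y hy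
  have hav := avg_dec (Psi_antitone k f t) (show 0 < u / 5 ^ d by positivity) hmu
  have hsub : ∫⁻ v in Ioo 0 (u / 5 ^ d), Psi k f t v ≤ ∫⁻ v in Ioo 0 u, Psi k f t v := by
    refine lintegral_mono_set (Ioo_subset_Ioo_right (div_le_self hu.le (one_le_pow₀ (by norm_num))))
  refine hsum.not_ge ((mul_le_mul_right (hint.trans (hav.trans (mul_le_mul_right hsub _))) c).trans (le_of_eq ?_))
  rw [hb, hmE]
  have e : ENNReal.ofReal (m / (u / 5 ^ d)) = ENNReal.ofReal m * 5 ^ d * (ENNReal.ofReal u)⁻¹ := by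
    rw [← ENNReal.ofReal_inv_of_pos hu, show (5 ^ d : ℝ≥0∞) = ENNReal.ofReal (5 ^ d) by rw [ENNReal.ofReal_pow (by norm_num), ENNReal.ofReal_ofNat],
      ← ENNReal.ofReal_mul hmpos.le, ← ENNReal.ofReal_mul (by positivity)]
    congr 1; field_simp
  rw [e]; ring

lemma modulus_mono {d k : ℕ} {f : Euc d → ℝ} {p : ℝ} {q : ℝ≥0∞} {s r : ℝ} (h : s ≤ r) :
    modulus k f p q s ≤ modulus k f p q r :=
  biSup_mono fun x (hx : ‖x‖ ≤ s) => (hx.trans h : ‖x‖ ≤ r)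

/-- DeVore-type inequality for the sharp maximal function, case `k > d/p`
(Theorem 1.1, (1.7)). -/
theorem statement0 (d : ℕ) (hd : 0 < d) (p : ℝ) (hp : 1 < p)
    (q : ℝ≥0∞) (hq : 0 < q) (k : ℕ) (hk : (d : ℝ) / p < (k : ℝ)) :
    ∃ C : ℝ, 0 < C ∧ ∀ f : Euc d → ℝ, Measurable f →
      lorentz volume f p q (Set.Ioi 0) ≠ ∞ →
      ∀ t : ℝ, 0 < t →
        ENNReal.ofReal (t ^ (-(d : ℝ) / p)) *
            qnorm q (Set.Ioo 0 (t ^ d))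
              (fun u => ENNReal.ofReal (u ^ (1 / p)) * rearr volume (sharp f) u) ≤
          ENNReal.ofReal C *
            ⨆ u ∈ Set.Ioi t, ENNReal.ofReal (u ^ (-(d : ℝ) / p)) * modulus k f p q u := by
  have hp0 : 0 < p := by linarith
  have hd' : (0:ℝ) < d := by exact_mod_cast hd
  have hk0 : 0 < k := by
    have : (0:ℝ) < k := lt_trans (by positivity) hk
    exact_mod_cast this
  obtain ⟨C0, C5, hC0, hC5, hrs⟩ := rearr_sharp d hd hq hp hk0
  obtain ⟨Ca, hCa, hadd⟩ := qnorm_add hq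
  obtain ⟨Cp, hCp, hpow⟩ := qnorm_pow hq hp
  obtain ⟨Ch, hCh, hhardy⟩ := hardy hq hp
  obtain ⟨Cs, hCs, hpsi⟩ := psi_bound d hq hp hk0
  set D := C0 * Cp + C5 * (Ch * (Cs * ENNReal.ofReal (((k:ℝ) + 1) ^ ((d:ℝ) / p)))) with hD
  have hDt : D ≠ ∞ := ENNReal.add_ne_top.2 ⟨ENNReal.mul_ne_top hC0 hCp,
    ENNReal.mul_ne_top hC5 (ENNReal.mul_ne_top hCh (ENNReal.mul_ne_top hCs (by simp)))⟩
  set T := Ca * D * ENNReal.ofReal (2 ^ ((d:ℝ) / p)) with hT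
  have hTt : T ≠ ∞ := ENNReal.mul_ne_top (ENNReal.mul_ne_top hCa hDt) (by simp)
  refine ⟨T.toReal + 1, by positivity, fun f hf hfin t ht => ?_⟩
  set K0 := ⨆ u ∈ Set.Ioi t, ENNReal.ofReal (u ^ (-(d : ℝ) / p)) * modulus k f p q u with hK0
  by_cases hK0t : K0 = ∞
  · rw [hK0t, ENNReal.mul_top (by simp; positivity)]
    exact le_top
  have hTle : T ≤ ENNReal.ofReal (T.toReal + 1) := by
    rw [ENNReal.ofReal_add ENNReal.toReal_nonneg zero_le_one, ENNReal.ofReal_toReal hTt]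
    exact le_self_add
  refine le_trans ?_ (mul_le_mul_left hTle _)
  set K := ENNReal.ofReal (2 ^ ((d:ℝ) / p)) * K0 with hK
  have hKt : K ≠ ∞ := ENNReal.mul_ne_top (by simp) hK0t
  have H : Hyp k f p q t K := by
    intro s hs
    have hs0 : 0 < s := ht.trans_le hs
    have h1 : ENNReal.ofReal ((2 * s) ^ (-(d : ℝ) / p)) * modulus k f p q (2 * s) ≤ K0 :=
      le_iSup₂ (f := fun u (_ : u ∈ Ioi t) => ENNReal.ofReal (u ^ (-(d : ℝ) / p)) * modulus k f p q u) (2 * s) (show t < 2 * s by linarith)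
    have e : s ^ (-(d : ℝ) / p) = 2 ^ ((d:ℝ) / p) * (2 * s) ^ (-(d : ℝ) / p) := by
      rw [Real.mul_rpow (by norm_num) hs0.le, ← mul_assoc, ← Real.rpow_add (by norm_num), neg_div, add_neg_cancel, Real.rpow_zero, one_mul]
    rw [e, ENNReal.ofReal_mul (by positivity), mul_assoc]
    refine mul_le_mul_right (le_trans (mul_le_mul_right (modulus_mono (by linarith)) _) h1) _
  have hmain : qnorm q (Set.Ioo 0 (t ^ d)) (fun u => ENNReal.ofReal (u ^ (1 / p)) * rearr volume (sharp f) u) ≤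
      Ca * (D * ENNReal.ofReal (t ^ ((d:ℝ) / p)) * K) := by
    refine (qnorm_mono measurableSet_Ioo (g' := fun u => (C0 * K) * ENNReal.ofReal (u ^ (1 / p)) +
      C5 * (ENNReal.ofReal (u ^ (1 / p)) * ((ENNReal.ofReal u)⁻¹ * ∫⁻ v in Ioo 0 u, Psi k f t v))) fun u hu => ?_).trans ?_
    · refine (mul_le_mul_right (hrs f hf hfin t ht K H u hu.1) _).trans (le_of_eq ?_)
      ring
    refine hadd _ measurableSet_Ioo _ _ (by fun_prop) _ ?_ ?_
    · rw [qnorm_const_mul hq _ _ (ENNReal.mul_ne_top hC0 hKt)]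
      refine (mul_le_mul_right (hpow (t ^ d) (by positivity)) _).trans ?_
      rw [← Real.rpow_natCast t d, ← Real.rpow_mul ht.le, mul_one_div, hD, add_mul, add_mul]
      refine le_trans (le_of_eq ?_) le_self_add
      ring
    · rw [qnorm_const_mul hq _ _ hC5]
      have h1 := (qnorm_mono_set (q := q) (show Ioo 0 (t ^ d) ⊆ Ioi (0:ℝ) from fun x hx => hx.1) _).trans (hhardy _ (Psi_antitone k f t))
      have hkt : t ≤ (k + 1) * t := by
        have : (0:ℝ) ≤ k := by positivity
        nlinarith
      have h2 := h1.trans (mul_le_mul_right ((hpsi f hf t ht).trans (mul_le_mul_right (H.mod ht hkt) _)) _)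
      refine (mul_le_mul_right h2 _).trans ?_
      rw [Real.mul_rpow (by positivity) ht.le, ENNReal.ofReal_mul (by positivity), hD, add_mul, add_mul]
      refine le_trans (le_of_eq ?_) le_add_self
      ring
  refine (mul_le_mul_right hmain _).trans (le_of_eq ?_)
  have e : ENNReal.ofReal (t ^ (-(d : ℝ) / p)) * ENNReal.ofReal (t ^ ((d:ℝ) / p)) = 1 := by
    rw [← ENNReal.ofReal_mul (by positivity), ← Real.rpow_add ht, neg_div, neg_add_cancel, Real.rpow_zero, ENNReal.ofReal_one]
  calc ENNReal.ofReal (t ^ (-(d : ℝ) / p)) * (Ca * (D * ENNReal.ofReal (t ^ ((d:ℝ) / p)) * K))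
      = (ENNReal.ofReal (t ^ (-(d : ℝ) / p)) * ENNReal.ofReal (t ^ ((d:ℝ) / p))) * (Ca * D * K) := by ring
    _ = T * K0 := by rw [e, hT, hK]; ring


end
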